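/- arXiv:2103.01784 — 4 statements merged into one kernel-verified Lean document; each statement's English description precedes it below -/
import Mathlib

section
/- Let p₁, p₂ ∈ 𝒪_K be two odd prime elements with v_{p₁} ≠ v_{p₂}. Assume that σ(p₁) > 0 for every real embedding σ : K → ℝ, that p₁ is a square in K_v for every finite place v of K above 2, and that p₂ is a square in K_{v_{p₁}}. Then for every finite place v of K, at least one of p₁, p₂, p₁p₂ is a square in K_v; equivalently, the equation (x₀² − p₁x₁²)(x₀² − p₂x₁²)(x₀² − p₁p₂x₁²) = 0 has a solution (x₀, x₁) ≠ (0,0) in K_v for every finite place v. -/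
open NumberField IsDedekindDomain

section GaussSum
open Complex Filter Topology HurwitzZeta

lemma jacobiTheta_eq_mul_jacobiTheta_neg_inv (τ : ℂ) :
    jacobiTheta τ = 1 / (-I * τ) ^ (1 / 2 : ℂ) * jacobiTheta (-1 / τ) := by
  rw [jacobiTheta_eq_jacobiTheta₂, jacobiTheta_eq_jacobiTheta₂, jacobiTheta₂_functional_equation]
  simp

lemma real_mul_cpow {t : ℝ} (ht : 0 < t) {z : ℂ} (hz : z ≠ 0) (s : ℂ) :
    ((t : ℂ) * z) ^ s = (t : ℂ) ^ s * z ^ s := by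
  have ht' : (t : ℂ) ≠ 0 := by exact_mod_cast ht.ne'
  rw [cpow_def_of_ne_zero (mul_ne_zero ht' hz), cpow_def_of_ne_zero ht', cpow_def_of_ne_zero hz,
    log_ofReal_mul ht hz, ← exp_add, ofReal_log ht.le]
  ring_nf

/-- The quadratic Gauss sum `∑ exp (2πi r² / 4A)` over residues `r` modulo `2A`. -/
noncomputable def evenGaussSum (A : ℕ) : ℂ :=
  ∑ r : Fin (2 * A), cexp (2 * Real.pi * I * ((r : ℂ) ^ 2 / (4 * A)))

lemma jacobiTheta_rational_cusp (A : ℕ) (hA : 0 < A) {t : ℝ} (ht : 0 < t) :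
    jacobiTheta (1 / (2 * A) + I * t) =
      ∑ r : Fin (2 * A), cexp (2 * Real.pi * I * ((r : ℂ) ^ 2 / (4 * A))) *
        evenKernel (((r : ℝ) / (2 * A) : ℝ) : UnitAddCircle) (4 * A ^ 2 * t) := by
  have : NeZero (2 * A) := ⟨by omega⟩
  have hA' : (A : ℂ) ≠ 0 := by exact_mod_cast hA.ne'
  have hAr : (A : ℝ) ≠ 0 := by exact_mod_cast hA.ne'
  have hτ : 0 < (1 / (2 * A) + I * t : ℂ).im := by
    have : (1 / (2 * A) + I * t : ℂ) = ((1 / (2 * A) : ℝ) : ℂ) + (t : ℂ) * I := by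
      push_cast; ring
    rw [this]; simp; simpa using ht
  have hs : Summable fun n : ℤ ↦ cexp (Real.pi * I * (n : ℂ) ^ 2 * (1 / (2 * A) + I * t)) := by
    have := (hasSum_jacobiTheta₂_term 0 hτ).summable
    simpa [jacobiTheta₂_term] using this
  rw [jacobiTheta]
  have hs' := (Int.divModEquiv (2 * A)).symm.summable_iff.mpr hs
  rw [← (Int.divModEquiv (2 * A)).symm.tsum_eq]
  rw [← (Equiv.prodComm _ _).summable_iff] at hs'
  rw [← (Equiv.prodComm _ _).tsum_eq]
  have hs'' := hs'
  simp only [Function.comp_def] at hs''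
  rw [hs''.tsum_prod, tsum_fintype]
  refine Finset.sum_congr rfl fun r _ ↦ ?_
  have hk := hasSum_int_evenKernel ((r : ℝ) / (2 * A)) (t := 4 * A ^ 2 * t) (by positivity)
  rw [← hasSum_ofReal] at hk
  rw [← hk.tsum_eq, ← tsum_mul_left]
  refine tsum_congr fun m ↦ ?_
  rw [ofReal_exp, ← Complex.exp_add]
  rw [Complex.exp_eq_exp_iff_exists_int]
  refine ⟨m * r + A * m ^ 2, ?_⟩
  simp [Int.divModEquiv_symm_apply]
  field_simp
  ring_nf
  simp only [I_sq]
  ring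

lemma tendsto_cosKernel (a : UnitAddCircle) : Tendsto (cosKernel a) atTop (𝓝 1) := by
  obtain ⟨p, hp, h⟩ := isBigO_atTop_cosKernel_sub a
  have h2 : Tendsto (fun x : ℝ ↦ Real.exp (-p * x)) atTop (𝓝 0) := by
    simpa [Function.comp_def] using
      Real.tendsto_exp_neg_atTop_nhds_zero.comp (tendsto_id.const_mul_atTop hp)
  simpa using (h.trans_tendsto h2).add_const 1

lemma tendsto_jacobiTheta_of_im {l : Filter ℝ} {f : ℝ → ℂ}
    (hf : Tendsto (fun t ↦ (f t).im) l atTop) : Tendsto (fun t ↦ jacobiTheta (f t)) l (𝓝 1) := by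
  have h := isBigO_at_im_infty_jacobiTheta_sub_one.comp_tendsto (tendsto_comap_iff.mpr hf)
  have h2 : Tendsto (fun t ↦ Real.exp (-Real.pi * (f t).im)) l (𝓝 0) := by
    simpa [Function.comp_def] using
      Real.tendsto_exp_neg_atTop_nhds_zero.comp (hf.const_mul_atTop Real.pi_pos)
  simpa using (h.trans_tendsto h2).add_const 1

lemma tendsto_sqrt_mul_jacobiTheta (A : ℕ) (hA : 0 < A) :
    Tendsto (fun t : ℝ ↦ (t : ℂ) ^ (1 / 2 : ℂ) * jacobiTheta (1 / (2 * A) + I * t)) (𝓝[>] 0)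
      (𝓝 (evenGaussSum A / (2 * A))) := by
  have hA' : (0 : ℝ) < A := by exact_mod_cast hA
  have h1 : ∀ r : Fin (2 * A), Tendsto (fun t : ℝ ↦ ((cosKernel (((r : ℝ) / (2 * A) : ℝ) :
      UnitAddCircle) (1 / (4 * A ^ 2 * t)) : ℝ) : ℂ)) (𝓝[>] 0) (𝓝 1) := fun r ↦ by
    rw [← ofReal_one]
    refine (continuous_ofReal.tendsto 1).comp ((tendsto_cosKernel _).comp ?_)
    have : (fun t : ℝ ↦ 1 / (4 * A ^ 2 * t)) = fun t ↦ (1 / (4 * A ^ 2) : ℝ) * t⁻¹ := by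
      ext t; field_simp
    rw [this]
    exact tendsto_inv_nhdsGT_zero.const_mul_atTop (by positivity)
  have h2 : Tendsto (fun t : ℝ ↦ ∑ r : Fin (2 * A),
      cexp (2 * Real.pi * I * ((r : ℂ) ^ 2 / (4 * A))) * (1 / (2 * A) * ((cosKernel
      (((r : ℝ) / (2 * A) : ℝ) : UnitAddCircle) (1 / (4 * A ^ 2 * t)) : ℝ) : ℂ))) (𝓝[>] 0)
      (𝓝 (∑ r : Fin (2 * A), cexp (2 * Real.pi * I * ((r : ℂ) ^ 2 / (4 * A))) *
        (1 / (2 * A) * 1))) :=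
    tendsto_finsetSum _ fun r _ ↦ ((h1 r).const_mul _).const_mul _
  rw [← Finset.sum_mul] at h2
  have hG : evenGaussSum A / (2 * A) = evenGaussSum A * (1 / (2 * A)) := by ring
  rw [hG, evenGaussSum]
  rw [mul_one (1 / (2 * (A : ℂ)))] at h2
  refine h2.congr' ?_
  filter_upwards [self_mem_nhdsWithin] with t ht
  have ht : 0 < t := ht
  rw [jacobiTheta_rational_cusp A hA ht, Finset.mul_sum]
  refine Finset.sum_congr rfl fun r _ ↦ ?_
  rw [evenKernel_functional_equation]
  have h3 : ((4 * A ^ 2 * t : ℝ)) ^ (1 / 2 : ℝ) = (2 * A) * t ^ (1 / 2 : ℝ) := by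
    rw [Real.mul_rpow (by positivity) ht.le, show (4 * A ^ 2 : ℝ) = (2 * A) ^ (2 : ℝ) by
      norm_cast; ring, ← Real.rpow_mul (by positivity)]
    norm_num
  rw [h3]
  have h4 : (t : ℂ) ^ (1 / 2 : ℂ) = ((t ^ (1 / 2 : ℝ) : ℝ) : ℂ) := by
    rw [ofReal_cpow ht.le]; norm_num
  rw [h4]
  have h5 : ((t ^ (1 / 2 : ℝ) : ℝ) : ℂ) ≠ 0 := by
    exact_mod_cast (Real.rpow_pos_of_pos ht _).ne'
  push_cast
  field_simp

/-- All the Gauss sums `evenGaussSum A` lie on a common ray. -/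
lemma evenGaussSum_eq (A : ℕ) (hA : 0 < A) :
    evenGaussSum A = ((2 * A : ℝ) ^ (1 / 2 : ℝ) : ℝ) * (1 / (-I) ^ (1 / 2 : ℂ)) := by
  have hA' : (A : ℂ) ≠ 0 := by exact_mod_cast hA.ne'
  have hAr : (0 : ℝ) < A := by exact_mod_cast hA
  have hden : ∀ t : ℝ, (1 + 2 * A * I * t : ℂ) ≠ 0 := fun t h ↦ by
    have := congrArg re h
    simp at this
  have hτ : ∀ t : ℝ, (1 / (2 * A) + I * t : ℂ) ≠ 0 := fun t h ↦ by
    apply hden t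
    have : (1 + 2 * A * I * t : ℂ) = 2 * A * (1 / (2 * A) + I * t) := by field_simp
    rw [this, h, mul_zero]
  -- the point `w` equivalent to `-1/τ` modulo even translations
  have key : ∀ t : ℝ, 0 < t → (t : ℂ) ^ (1 / 2 : ℂ) * jacobiTheta (1 / (2 * A) + I * t) =
      1 / (-I * (1 / (2 * A) + I * t)) ^ (1 / 2 : ℂ) *
        (1 / (4 * A ^ 2 / (1 + 2 * A * I * t)) ^ (1 / 2 : ℂ)) *
        jacobiTheta (I / (4 * A ^ 2 * t) - 1 / (2 * A)) := fun t ht ↦ by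
    have ht' : (t : ℂ) ≠ 0 := by exact_mod_cast ht.ne'
    have hper : jacobiTheta (-1 / (1 / (2 * A) + I * t)) =
        jacobiTheta (4 * A ^ 2 * I * t / (1 + 2 * A * I * t)) := by
      have hp : Function.Periodic jacobiTheta 2 := fun τ ↦ by rw [add_comm, jacobiTheta_two_add]
      rw [← hp.nat_mul A]
      congr 1
      have h1 := hτ t
      have h2 := hden t
      have h3 : (1 / (2 * A) + I * t : ℂ) = (1 + 2 * A * I * t) / (2 * A) := by field_simp
      rw [h3]
      field_simp
      ring
    have hz : (4 * A ^ 2 / (1 + 2 * A * I * t) : ℂ) ≠ 0 :=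
      div_ne_zero (by simpa using hA') (hden t)
    rw [jacobiTheta_eq_mul_jacobiTheta_neg_inv, hper,
      jacobiTheta_eq_mul_jacobiTheta_neg_inv (4 * A ^ 2 * I * t / (1 + 2 * A * I * t))]
    have h4 : -I * (4 * A ^ 2 * I * t / (1 + 2 * A * I * t)) =
        (t : ℂ) * (4 * A ^ 2 / (1 + 2 * A * I * t)) := by
      have := hden t
      field_simp
      simp [neg_div]
    have h5 : -1 / (4 * A ^ 2 * I * t / (1 + 2 * A * I * t)) =
        (I / (4 * A ^ 2 * t) - 1 / (2 * A) : ℂ) := by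
      have := hden t
      field_simp
      ring_nf
      simp
      try ring
    rw [h4, h5, real_mul_cpow ht hz]
    have h6 : (t : ℂ) ^ (1 / 2 : ℂ) ≠ 0 := by simp [ht']
    field_simp
  have lim1 := tendsto_sqrt_mul_jacobiTheta A hA
  have hc1 : Tendsto (fun t : ℝ ↦ (-I * (1 / (2 * A) + I * t) : ℂ) ^ (1 / 2 : ℂ)) (𝓝[>] 0)
      (𝓝 ((-I * (1 / (2 * A))) ^ (1 / 2 : ℂ))) := by
    have : ContinuousAt (fun t : ℝ ↦ (-I * (1 / (2 * A) + I * t) : ℂ) ^ (1 / 2 : ℂ)) 0 := by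
      refine ContinuousAt.cpow (by fun_prop) continuousAt_const ?_
      right
      simp [hAr.ne']
    have := this.tendsto.mono_left (nhdsWithin_le_nhds (s := Set.Ioi 0))
    simpa using this
  have hc2 : Tendsto (fun t : ℝ ↦ (4 * A ^ 2 / (1 + 2 * A * I * t) : ℂ) ^ (1 / 2 : ℂ)) (𝓝[>] 0)
      (𝓝 (2 * A)) := by
    have : ContinuousAt (fun t : ℝ ↦ (4 * A ^ 2 / (1 + 2 * A * I * t) : ℂ) ^ (1 / 2 : ℂ)) 0 := by
      refine ContinuousAt.cpow ?_ continuousAt_const ?_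
      · exact ContinuousAt.div (by fun_prop) (by fun_prop) (by simp)
      left
      have h : (4 * (A : ℂ) ^ 2 / (1 + 2 * A * I * ((0 : ℝ) : ℂ))) = ((4 * A ^ 2 : ℝ) : ℂ) := by
        push_cast; ring
      rw [h, ofReal_re]
      positivity
    have := this.tendsto.mono_left (nhdsWithin_le_nhds (s := Set.Ioi 0))
    have h7 : (4 * (A : ℂ) ^ 2) ^ (2⁻¹ : ℂ) = 2 * A := by
      rw [show (4 * (A : ℂ) ^ 2) = ((4 * A ^ 2 : ℝ) : ℂ) by push_cast; ring,
        show (2⁻¹ : ℂ) = ((2⁻¹ : ℝ) : ℂ) by push_cast; ring, ← ofReal_cpow (by positivity)]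
      rw [show (4 * A ^ 2 : ℝ) = (2 * A) ^ (2 : ℝ) by norm_cast; ring,
        ← Real.rpow_mul (by positivity)]
      norm_num
    simpa [h7] using this
  have hc3 : Tendsto (fun t : ℝ ↦ jacobiTheta (I / (4 * A ^ 2 * t) - 1 / (2 * A))) (𝓝[>] 0)
      (𝓝 1) := by
    apply tendsto_jacobiTheta_of_im
    have : (fun t : ℝ ↦ (I / (4 * A ^ 2 * t) - 1 / (2 * A) : ℂ).im) =
        fun t ↦ (1 / (4 * A ^ 2) : ℝ) * t⁻¹ := by
      ext t
      rw [show (I / (4 * A ^ 2 * t) - 1 / (2 * A) : ℂ) =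
        ((1 / (4 * A ^ 2 * t) : ℝ) : ℂ) * I - ((1 / (2 * A) : ℝ) : ℂ) by push_cast; ring]
      rw [sub_im, ofReal_im, im_ofReal_mul, I_im]
      ring
    rw [this]
    exact tendsto_inv_nhdsGT_zero.const_mul_atTop (by positivity)
  have hI : (-I * (1 / (2 * A)) : ℂ) ^ (1 / 2 : ℂ) =
      ((1 / (2 * A) : ℝ) : ℂ) ^ (1 / 2 : ℂ) * (-I) ^ (1 / 2 : ℂ) := by
    rw [← real_mul_cpow (by positivity) (by simp)]
    push_cast
    ring_nf
  have hI0 : (-I) ^ (1 / 2 : ℂ) ≠ 0 := by simp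
  have h8 : ((1 / (2 * A) : ℝ) : ℂ) ^ (1 / 2 : ℂ) =
      (((1 / (2 * A) : ℝ) ^ (1 / 2 : ℝ) : ℝ) : ℂ) := by
    rw [ofReal_cpow (by positivity)]; norm_num
  have h9 : (((1 / (2 * A) : ℝ) ^ (1 / 2 : ℝ) : ℝ) : ℂ) =
      ((((2 * A : ℝ) ^ (1 / 2 : ℝ) : ℝ) : ℂ))⁻¹ := by
    rw [one_div, Real.inv_rpow (by positivity)]; push_cast; rfl
  have h10 : (((2 * A : ℝ) ^ (1 / 2 : ℝ) : ℝ) : ℂ) ≠ 0 := by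
    exact_mod_cast (Real.rpow_pos_of_pos (by positivity) _).ne'
  have lim2 := ((tendsto_const_nhds (x := (1 : ℂ)).div hc1 (by rw [hI, h8, h9]; simp [hA.ne'])).mul
    (tendsto_const_nhds (x := (1 : ℂ)).div hc2 (by simpa using hA'))).mul hc3
  have := tendsto_nhds_unique lim1 (lim2.congr' (by
    filter_upwards [self_mem_nhdsWithin] with t ht
    exact (key t ht).symm))
  rw [hI, h8, h9] at this
  field_simp at this ⊢
  exact this

end GaussSum

section LatticeGaussSum
open Complex ComplexConjugate

/-- `x ↦ exp (2πix)` on rational numbers. -/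
noncomputable def ratExp (x : ℚ) : ℂ := cexp (2 * Real.pi * I * x)

lemma ratExp_add (x y : ℚ) : ratExp (x + y) = ratExp x * ratExp y := by
  simp [ratExp, ← Complex.exp_add, mul_add]

lemma ratExp_zero : ratExp 0 = 1 := by simp [ratExp]

lemma ratExp_eq_one_iff {x : ℚ} : ratExp x = 1 ↔ ∃ n : ℤ, x = n := by
  rw [ratExp, Complex.exp_eq_one_iff]
  refine exists_congr fun n ↦ ?_
  rw [mul_comm (n : ℂ), mul_right_inj' Complex.two_pi_I_ne_zero]
  exact_mod_cast Iff.rfl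

lemma ratExp_int (n : ℤ) : ratExp n = 1 := ratExp_eq_one_iff.mpr ⟨n, rfl⟩

lemma ratExp_congr {x y : ℚ} (n : ℤ) (h : x = y + n) : ratExp x = ratExp y := by
  rw [h, ratExp_add, ratExp_int, mul_one]

lemma conj_ratExp (x : ℚ) : conj (ratExp x) = ratExp (-x) := by
  rw [ratExp, ratExp, ← Complex.exp_conj]
  simp [Complex.conj_ofNat]

lemma ratExp_sum {ι : Type*} (s : Finset ι) (f : ι → ℚ) :
    ratExp (∑ i ∈ s, f i) = ∏ i ∈ s, ratExp (f i) := by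
  simp [ratExp, ← Complex.exp_sum, Finset.mul_sum]

/-- A sum of a function on a finite group which transforms by characters under a subgroup `H` is
supported on the elements whose character is trivial on `H`. -/
lemma sum_eq_sum_filter_of_addChar {A : Type*} [AddCommGroup A] [Fintype A] (φ : A → ℂ)
    (H : AddSubgroup A) (χ : A → AddChar A ℂ) (hφ : ∀ x, ∀ h ∈ H, φ (x + h) = φ x * χ x h)
    [DecidablePred fun x ↦ ∀ h ∈ H, χ x h = 1] :
    ∑ x, φ x = ∑ x with ∀ h ∈ H, χ x h = 1, φ x := by
  classical
  have h1 : (Fintype.card H : ℂ) * ∑ x, φ x = ∑ x, φ x * ∑ h : H, χ x h := by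
    simp_rw [Finset.mul_sum]
    rw [Finset.sum_comm]
    have : ∀ h : H, ∑ x, φ x * χ x h = ∑ x, φ x := fun h ↦ by
      rw [← Equiv.sum_comp (Equiv.addRight (h : A)) φ]
      exact Finset.sum_congr rfl fun x _ ↦ (hφ x h h.2).symm
    simp [this, Finset.mul_sum]
  have h2 : ∀ x, ∑ h : H, χ x h = if ∀ h ∈ H, χ x h = 1 then (Fintype.card H : ℂ) else 0 := by
    intro x
    have := AddChar.sum_eq_ite ((χ x).compAddMonoidHom H.subtype)
    simp only [AddChar.compAddMonoidHom_apply, AddSubgroup.coe_subtype] at this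
    rw [this]
    refine if_congr ?_ rfl rfl
    rw [AddChar.eq_zero_iff]
    simp
  rw [Finset.sum_filter]
  have h3 : (Fintype.card H : ℂ) ≠ 0 := by exact_mod_cast Fintype.card_ne_zero
  apply mul_left_cancel₀ h3
  rw [h1, Finset.mul_sum]
  refine Finset.sum_congr rfl fun x _ ↦ ?_
  rw [h2]
  split_ifs <;> ring

lemma sum_comp_eq_card_ker_mul {A B : Type*} [AddCommGroup A] [AddCommGroup B] [Fintype A]
    [Fintype B] (π : A →+ B) (hπ : Function.Surjective π) (g : B → ℂ) :
    ∑ a, g (π a) = Nat.card π.ker * ∑ b, g b := by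
  classical
  rw [← Finset.sum_fiberwise Finset.univ π, Finset.mul_sum]
  refine Finset.sum_congr rfl fun b _ ↦ ?_
  rw [Finset.sum_congr rfl (g := fun _ ↦ g b) (by simp +contextual), Finset.sum_const,
    nsmul_eq_mul]
  congr 2
  obtain ⟨a, rfl⟩ := hπ b
  rw [← AddMonoidHom.card_fiber_eq_of_mem_range π ⟨0, map_zero π⟩ ⟨a, rfl⟩, Nat.card_eq_fintype_card,
    Fintype.card_subtype]
  simp [AddMonoidHom.mem_ker]

/-- If a function on a group factors through two finite quotients, its sums over these quotients
are positive multiples of each other. -/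
lemma exists_pos_mul_sum_eq {Λ A B : Type*} [AddCommGroup Λ] [AddCommGroup A] [AddCommGroup B]
    [Fintype A] [Fintype B] (π : Λ →+ A) (ρ : Λ →+ B) (hπ : Function.Surjective π)
    (hρ : Function.Surjective ρ) (f : A → ℂ) (g : B → ℂ) (h : ∀ x, f (π x) = g (ρ x)) :
    ∃ r : ℝ, 0 < r ∧ ∑ b, g b = r * ∑ a, f a := by
  classical
  let σ : Λ →+ A × B := π.prod ρ
  let C := σ.range
  have e1 := sum_comp_eq_card_ker_mul ((AddMonoidHom.fst A B).comp C.subtype)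
    (fun a ↦ by obtain ⟨x, rfl⟩ := hπ a; exact ⟨⟨σ x, x, rfl⟩, rfl⟩) f
  have e2 := sum_comp_eq_card_ker_mul ((AddMonoidHom.snd A B).comp C.subtype)
    (fun a ↦ by obtain ⟨x, rfl⟩ := hρ a; exact ⟨⟨σ x, x, rfl⟩, rfl⟩) g
  have e3 : ∀ c : C, f (((AddMonoidHom.fst A B).comp C.subtype) c) =
      g (((AddMonoidHom.snd A B).comp C.subtype) c) := by
    rintro ⟨_, x, rfl⟩
    exact h x
  rw [Finset.sum_congr rfl fun c _ ↦ e3 c, e2] at e1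
  set m := Nat.card ((AddMonoidHom.fst A B).comp C.subtype).ker
  set n := Nat.card ((AddMonoidHom.snd A B).comp C.subtype).ker
  have hm : 0 < m := Nat.card_pos
  have hn : 0 < n := Nat.card_pos
  refine ⟨m / n, by positivity, ?_⟩
  have : (n : ℂ) ≠ 0 := by exact_mod_cast hn.ne'
  push_cast
  field_simp
  linear_combination e1

/-- The eighth root of unity governing the direction of `evenGaussSum`. -/
lemma norm_gaussDirection : ‖(1 / (-I) ^ (1 / 2 : ℂ) : ℂ)‖ = 1 := by
  have h : ‖(-I) ^ (1 / 2 : ℂ)‖ = 1 := by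
    have := Complex.norm_cpow_real (-I) (1 / 2)
    simpa using this
  rw [norm_div, h]; simp

lemma sum_zmod_ratExp_of_pos (A : ℤ) (hA : 0 < A) [NeZero (2 * A.natAbs)] :
    ∑ x : ZMod (2 * A.natAbs), ratExp ((x.val : ℚ) ^ 2 / (4 * A)) = evenGaussSum A.natAbs := by
  rw [evenGaussSum, ← (ZMod.finEquiv (2 * A.natAbs)).toEquiv.sum_comp]
  refine Finset.sum_congr rfl fun r _ ↦ ?_
  have h1 : ((ZMod.finEquiv (2 * A.natAbs)).toEquiv r).val = (r : ℕ) := by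
    generalize 2 * A.natAbs = n at *
    cases n with
    | zero => exact r.elim0
    | succ n => rfl
  have h2 : ((A.natAbs : ℕ) : ℂ) = (A : ℂ) := by
    have : ((A.natAbs : ℕ) : ℤ) = A := Int.natAbs_of_nonneg hA.le
    have := congrArg (Int.cast : ℤ → ℂ) this
    rwa [Int.cast_natCast] at this
  rw [h1, ratExp, h2]
  push_cast
  rfl

lemma sum_zmod_ratExp_eq (A : ℤ) (hA : A ≠ 0) [NeZero (2 * A.natAbs)] :
    ∃ r : ℝ, 0 < r ∧ ∑ x : ZMod (2 * A.natAbs), ratExp ((x.val : ℚ) ^ 2 / (4 * A)) =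
      r * (if 0 < A then (1 / (-I) ^ (1 / 2 : ℂ)) else conj (1 / (-I) ^ (1 / 2 : ℂ))) := by
  have hA0 : 0 < A.natAbs := Int.natAbs_pos.mpr hA
  refine ⟨_, Real.rpow_pos_of_pos (by positivity : (0 : ℝ) < 2 * A.natAbs) (1 / 2), ?_⟩
  split_ifs with h
  · rw [sum_zmod_ratExp_of_pos A h, evenGaussSum_eq _ hA0]
  · have h' : 0 < -A := by omega
    have e := evenGaussSum_eq _ hA0
    have : NeZero (2 * (-A).natAbs) := by rw [Int.natAbs_neg]; infer_instance
    have e2 := sum_zmod_ratExp_of_pos (-A) h'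
    rw [← Int.natAbs_neg A, ← e2] at e
    have e3 := congrArg conj e
    rw [map_sum, map_mul, conj_ofReal] at e3
    simp only [conj_ratExp] at e3
    have key : ∀ m (h : m = A.natAbs) [NeZero (2 * m)], ∑ x : ZMod (2 * A.natAbs), ratExp ((x.val : ℚ) ^ 2 / (4 * A)) =
      ∑ x : ZMod (2 * m), ratExp (-((x.val : ℚ) ^ 2 / (4 * ((-A : ℤ) : ℚ)))) := by
        rintro m rfl _
        refine Finset.sum_congr (by congr) fun x _ ↦ ?_
        push_cast
        congr 1
        rw [mul_neg, div_neg, neg_neg]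
    rw [key _ (Int.natAbs_neg A), e3, Int.natAbs_neg]

end LatticeGaussSum

section Milgram
open Complex ComplexConjugate

/-- The reduction map `ℤ^ι → ∏ ℤ/N_i`. -/
def piZModCast {ι : Type*} (N : ι → ℕ) : (ι → ℤ) →+ (∀ i, ZMod (N i)) where
  toFun n i := n i
  map_zero' := by ext; simp
  map_add' _ _ := by ext; simp

lemma piZModCast_surjective {ι : Type*} (N : ι → ℕ) : Function.Surjective (piZModCast N) := by
  intro x
  choose f hf using fun i ↦ ZMod.intCast_surjective (x i)
  exact ⟨f, funext hf⟩

/-- The pairing of `∏ ℤ/2|A_i|` with itself given by the form `∑ n_i m_i / 2A_i`. -/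
noncomputable def piZModPairing {ι : Type*} [Fintype ι] (A : ι → ℤ)
    [∀ i, NeZero (2 * (A i).natAbs)] (x : ∀ i, ZMod (2 * (A i).natAbs)) :
    AddChar (∀ i, ZMod (2 * (A i).natAbs)) ℂ where
  toFun h := ∏ i, ZMod.stdAddChar (((A i).sign : ZMod (2 * (A i).natAbs)) * x i * h i)
  map_zero_eq_one' := by simp
  map_add_eq_mul' h h' := by
    simp [mul_add, AddChar.map_add_eq_mul, Finset.prod_mul_distrib]

lemma piZModPairing_cast {ι : Type*} [Fintype ι] (A : ι → ℤ) 
    [∀ i, NeZero (2 * (A i).natAbs)] (n m : ι → ℤ) :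
    piZModPairing A (piZModCast _ n) (piZModCast _ m) =
      ratExp (∑ i, (n i * m i : ℚ) / (2 * A i)) := by
  have hA : ∀ i, A i ≠ 0 := fun i h ↦ NeZero.ne (2 * (A i).natAbs) (by simp [h])
  rw [ratExp_sum]
  refine Finset.prod_congr rfl fun i _ ↦ ?_
  have : ((A i).sign : ZMod (2 * (A i).natAbs)) * (piZModCast (fun i ↦ 2 * (A i).natAbs) n i) * (piZModCast (fun i ↦ 2 * (A i).natAbs) m i) =
    (((A i).sign * n i * m i : ℤ) : ZMod (2 * (A i).natAbs)) := by simp [piZModCast]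
  rw [this, ZMod.stdAddChar_coe, ratExp]
  congr 1
  have e : ((A i).natAbs : ℂ) * (A i).sign = A i := by
    have := Int.sign_mul_natAbs (A i)
    have := congrArg (Int.cast : ℤ → ℂ) this
    rw [Int.cast_mul, Int.cast_natCast] at this
    rw [mul_comm]; exact this
  have e' : ((A i).sign : ℂ) * (A i).sign = 1 := by
    have : (A i).sign * (A i).sign = 1 := by
      rcases lt_or_gt_of_ne (hA i) with h | h
      · simp [Int.sign_eq_neg_one_of_neg h]
      · simp [Int.sign_eq_one_of_pos h]
    exact_mod_cast this
  have h0 : (A i : ℂ) ≠ 0 := by exact_mod_cast hA i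
  have h1 : ((A i).natAbs : ℂ) ≠ 0 := by
    have := Int.natAbs_ne_zero.mpr (hA i)
    exact_mod_cast Nat.cast_ne_zero.mpr this
  rw [Nat.cast_mul]
  push_cast only [Rat.cast_div, Rat.cast_mul, Rat.cast_intCast, Int.cast_mul, Rat.cast_ofNat, Nat.cast_ofNat]
  rw [← e]
  have h2 : ((A i).sign : ℂ) ≠ 0 := left_ne_zero_of_mul_eq_one e'
  field_simp
  linear_combination e' * (n i * m i : ℂ)

/-- The quadratic function `ratExp (∑ x_i² / 4A_i)` on `∏ ℤ/2|A_i|`. -/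
noncomputable def piZModGauss {ι : Type*} [Fintype ι] (A : ι → ℤ)
    (x : ∀ i, ZMod (2 * (A i).natAbs)) : ℂ :=
  ∏ i, ratExp (((x i).val : ℚ) ^ 2 / (4 * A i))

lemma piZModGauss_cast {ι : Type*} [Fintype ι] (A : ι → ℤ)
    [∀ i, NeZero (2 * (A i).natAbs)] (n : ι → ℤ) :
    piZModGauss A (piZModCast _ n) = ratExp (∑ i, (n i * n i : ℚ) / (2 * A i) / 2) := by
  have hA : ∀ i, A i ≠ 0 := fun i h ↦ NeZero.ne (2 * (A i).natAbs) (by simp [h])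
  rw [ratExp_sum]
  refine Finset.prod_congr rfl fun i _ ↦ ?_
  obtain ⟨k, hk⟩ : ∃ k : ℤ, (((piZModCast (fun i ↦ 2 * (A i).natAbs) n i : ZMod (2 * (A i).natAbs)).val : ℤ) : ℤ) =
      n i + 2 * A i * k := by
    have h1 : (((piZModCast (fun i ↦ 2 * (A i).natAbs) n i : ZMod (2 * (A i).natAbs)).val : ℤ) :
        ZMod (2 * (A i).natAbs)) = (n i : ℤ) := by
      simp [piZModCast]
    rw [eq_comm, ZMod.intCast_eq_intCast_iff_dvd_sub] at h1
    have h2 : 2 * A i ∣ ((2 * (A i).natAbs : ℕ) : ℤ) := by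
      rw [Nat.cast_mul]
      exact mul_dvd_mul_left _ (Int.dvd_natAbs.mpr dvd_rfl)
    obtain ⟨k, hk⟩ := h2.trans h1
    exact ⟨k, by linarith⟩
  have hk' := congrArg (Int.cast : ℤ → ℚ) hk
  rw [Int.cast_natCast] at hk'
  rw [hk']
  apply ratExp_congr (n i * k + A i * k ^ 2)
  have h0 : (A i : ℚ) ≠ 0 := by exact_mod_cast hA i
  push_cast
  field_simp
  ring

lemma sum_piZModGauss_pos {ι : Type*} [Fintype ι] [DecidableEq ι] (A : ι → ℤ)
    [∀ i, NeZero (2 * (A i).natAbs)]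
    (hsig : Fintype.card {i // 0 < A i} = Fintype.card {i // A i < 0}) :
    ∃ r : ℝ, 0 < r ∧ ∑ x, piZModGauss A x = r := by
  have hA : ∀ i, A i ≠ 0 := fun i h ↦ NeZero.ne (2 * (A i).natAbs) (by simp [h])
  choose r hr h using fun i ↦ sum_zmod_ratExp_eq (A i) (hA i)
  refine ⟨∏ i, r i, Finset.prod_pos fun i _ ↦ hr i, ?_⟩
  have : ∑ x, piZModGauss A x =
      ∏ i, ∑ x : ZMod (2 * (A i).natAbs), ratExp ((x.val : ℚ) ^ 2 / (4 * A i)) := by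
    rw [Finset.prod_univ_sum, Fintype.piFinset_univ]
    rfl
  rw [this, Finset.prod_congr rfl fun i _ ↦ h i, Finset.prod_mul_distrib, ofReal_prod,
    Finset.prod_ite, Finset.prod_const, Finset.prod_const]
  have hc : (Finset.univ.filter fun i ↦ ¬ 0 < A i).card =
      (Finset.univ.filter fun i ↦ 0 < A i).card := by
    rw [← Fintype.card_subtype, ← Fintype.card_subtype, hsig]
    exact Fintype.card_congr (Equiv.subtypeEquivRight fun i ↦ by
      have := hA i
      omega)
  rw [hc, ← mul_pow, mul_conj, normSq_eq_norm_sq, norm_gaussDirection]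
  simp

/-- Positivity of the Gauss sum of a rational quadratic form with signature zero. -/
theorem gauss_sum_pos {V : Type*} [AddCommGroup V] [Module ℚ V] (b : LinearMap.BilinForm ℚ V)
    (hb : ∀ x y, b x y = b y x) {ι : Type*} [Fintype ι] [DecidableEq ι] (E : Module.Basis ι ℚ V)
    (A : ι → ℤ) (horth : ∀ i j, b (E i) (E j) = if i = j then 2 * (A i : ℚ) else 0)
    (hA : ∀ i, A i ≠ 0)
    (hsig : Fintype.card {i // 0 < A i} = Fintype.card {i // A i < 0})
    (Λ H : AddSubgroup V) (hH : ∀ x ∈ H, ∃ n : ℤ, b x x = 2 * n)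
    (hHΛ : ∀ x, x ∈ Λ ↔ ∀ h ∈ H, ∃ n : ℤ, b x h = n) (hE : ∀ i, E i ∈ H)
    {B : Type*} [AddCommGroup B] [Fintype B] (π : Λ →+ B) (hπ : Function.Surjective π)
    (g : B → ℂ) (hg : ∀ x : Λ, g (π x) = ratExp (b x x / 2)) :
    ∃ r : ℝ, 0 < r ∧ ∑ y, g y = r := by
  classical
  have : ∀ i, NeZero (2 * (A i).natAbs) := fun i ↦ ⟨by have := hA i; omega⟩
  have hA' : ∀ i, (A i : ℚ) ≠ 0 := fun i ↦ by exact_mod_cast hA i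
  let S : (ι → ℤ) →+ V :=
    { toFun n := ∑ i, ((n i : ℚ) / (2 * A i)) • E i
      map_zero' := by simp
      map_add' n m := by simp [add_div, add_smul, Finset.sum_add_distrib] }
  have hS : ∀ n, S n = ∑ i, ((n i : ℚ) / (2 * A i)) • E i := fun _ ↦ rfl
  have hSE : ∀ n j, b (S n) (E j) = n j := by
    intro n j
    have := hA' j
    rw [hS, map_sum, LinearMap.sum_apply, Finset.sum_eq_single j]
    · simp [horth]; field_simp
    · intro i _ hij; simp [horth, hij]
    · simp
  have hbS : ∀ n m, b (S n) (S m) = ∑ i, (n i * m i : ℚ) / (2 * A i) := by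
    intro n m
    rw [hS m, map_sum]
    refine Finset.sum_congr rfl fun i _ ↦ ?_
    rw [map_smul, hSE, smul_eq_mul]; ring
  have hrange : ∀ x, (∀ i, ∃ n : ℤ, b x (E i) = n) → ∃ n, S n = x := by
    intro x hx
    choose n hn using hx
    refine ⟨n, ?_⟩
    rw [hS]
    conv_rhs => rw [← E.sum_repr x]
    refine Finset.sum_congr rfl fun i _ ↦ ?_
    congr 1
    rw [← hn]
    conv_lhs => rw [← E.sum_repr x]
    rw [map_sum, LinearMap.sum_apply, Finset.sum_eq_single i]
    · simp [horth]
      have := hA' i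
      field_simp
    · intro j _ hij; simp [horth, hij]
    · simp
  have hHH : ∀ h ∈ H, ∀ h' ∈ H, ∃ n : ℤ, b h h' = n := by
    intro h hh h' hh'
    obtain ⟨a, ha⟩ := hH _ hh
    obtain ⟨a', ha'⟩ := hH _ hh'
    obtain ⟨a'', ha''⟩ := hH _ (H.add_mem hh hh')
    refine ⟨a'' - a - a', ?_⟩
    simp only [map_add, LinearMap.add_apply, hb h' h] at ha''
    push_cast
    linarith
  let red := piZModCast fun i ↦ 2 * (A i).natAbs
  have hred : Function.Surjective red := piZModCast_surjective _
  have hφ : ∀ n, piZModGauss A (red n) = ratExp (b (S n) (S n) / 2) := by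
    intro n
    rw [piZModGauss_cast, hbS, Finset.sum_div]
  have hχ : ∀ n m, piZModPairing A (red n) (red m) = ratExp (b (S n) (S m)) := by
    intro n m
    rw [piZModPairing_cast, hbS]
  have hsum := sum_eq_sum_filter_of_addChar (piZModGauss A) ((H.comap S).map red)
    (piZModPairing A) (by
      rintro x _ ⟨m, hm, rfl⟩
      obtain ⟨n, rfl⟩ := hred x
      obtain ⟨k, hk⟩ := hH _ hm
      rw [← map_add, hφ, hφ, hχ, ← ratExp_add]
      apply ratExp_congr k
      simp only [map_add, LinearMap.add_apply, hb (S m) (S n), hk]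
      ring)
  have hfilter : ∀ x, (∀ h ∈ (H.comap S).map red, piZModPairing A x h = 1) ↔
      x ∈ (Λ.comap S).map red := by
    intro x
    constructor
    · intro h
      obtain ⟨n, rfl⟩ := hred x
      refine ⟨n, ?_, rfl⟩
      refine (hHΛ _).mpr fun y hy ↦ ?_
      obtain ⟨m, rfl⟩ := hrange y fun i ↦ hHH y hy _ (hE i)
      rw [← ratExp_eq_one_iff, ← hχ]
      exact h _ ⟨m, hy, rfl⟩
    · rintro ⟨n, hn, rfl⟩ _ ⟨m, hm, rfl⟩
      rw [hχ, ratExp_eq_one_iff]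
      exact (hHΛ _).mp hn _ hm
  simp_rw [hfilter] at hsum
  obtain ⟨r, hr, hr'⟩ := sum_piZModGauss_pos A hsig
  let L := (Λ.comap S).map red
  obtain ⟨t, ht, ht'⟩ := exists_pos_mul_sum_eq (red.addSubgroupMap (Λ.comap S))
    (π.comp ((S.comp (Λ.comap S).subtype).codRestrict Λ fun n ↦ n.2))
    (red.addSubgroupMap_surjective _) (by
      intro y
      obtain ⟨⟨x, hx⟩, rfl⟩ := hπ y
      obtain ⟨n, rfl⟩ := hrange x fun i ↦ (hHΛ _).mp hx _ (hE i)
      exact ⟨⟨n, hx⟩, rfl⟩)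
    (fun x ↦ piZModGauss A x) g (by
      rintro ⟨n, hn⟩
      exact (hφ n).trans (hg ⟨S n, hn⟩).symm)
  refine ⟨t * r, mul_pos ht hr, ?_⟩
  rw [ht', ofReal_mul, ← hr', hsum]
  congr 1
  rw [← Finset.sum_subtype_eq_sum_filter]
  refine Finset.sum_bij (fun x _ ↦ ⟨x.1, x.2⟩) ?_ ?_ ?_ ?_ <;> simp
end Milgram

section Signature

/-- The form `x² + bxy + ty²`. -/
def binForm {S : Type*} [CommRing S] (b t : S) (u : S × S) : S :=
  u.1 ^ 2 + b * u.1 * u.2 + t * u.2 ^ 2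

/-- The polar form of `x² + bxy + ty²`. -/
def binPolar {S : Type*} [CommRing S] (b t : S) (u v : S × S) : S :=
  2 * u.1 * v.1 + b * (u.1 * v.2 + u.2 * v.1) + 2 * t * u.2 * v.2

lemma binPolar_self {S : Type*} [CommRing S] (b t : S) (u : S × S) :
    binPolar b t u u = 2 * binForm b t u := by simp only [binPolar, binForm]; ring

lemma binPolar_comm {S : Type*} [CommRing S] (b t : S) (u v : S × S) :
    binPolar b t u v = binPolar b t v u := by simp only [binPolar]; ring

lemma map_binPolar {S T : Type*} [CommRing S] [CommRing T] (f : S →+* T) (b t : S) (u v : S × S) :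
    f (binPolar b t u v) = binPolar (f b) (f t) (u.map f f) (v.map f f) := by
  simp [binPolar, map_ofNat]

lemma map_binForm {S T : Type*} [CommRing S] [CommRing T] (f : S →+* T) (b t : S) (u : S × S) :
    f (binForm b t u) = binForm (f b) (f t) (u.map f f) := by
  simp [binForm]

/-- The bilinear form `τ (l * B(u, v))` where `B` is the polar form of `x² + bxy + ty²`. -/
def binPolarForm {k S : Type*} [CommRing k] [CommRing S] [Algebra k S] (τ : S →ₗ[k] k)
    (l b t : S) : LinearMap.BilinForm k (S × S) :=
  LinearMap.mk₂ k (fun u v ↦ τ (l * binPolar b t u v))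
    (fun u u' v ↦ by rw [← map_add]; congr 1; simp only [binPolar, Prod.fst_add, Prod.snd_add]; ring)
    (fun c u v ↦ by
      rw [← map_smul]; congr 1
      simp only [binPolar, Prod.smul_fst, Prod.smul_snd]; simp only [Algebra.smul_def]; ring)
    (fun u v v' ↦ by rw [← map_add]; congr 1; simp only [binPolar, Prod.fst_add, Prod.snd_add]; ring)
    (fun c u v ↦ by
      rw [← map_smul]; congr 1
      simp only [binPolar, Prod.smul_fst, Prod.smul_snd]; simp only [Algebra.smul_def]; ring)

lemma binPolarForm_apply {k S : Type*} [CommRing k] [CommRing S] [Algebra k S] (τ : S →ₗ[k] k)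
    (l b t : S) (u v : S × S) : binPolarForm τ l b t u v = τ (l * binPolar b t u v) := rfl

lemma binPolarForm_comm {k S : Type*} [CommRing k] [CommRing S] [Algebra k S] (τ : S →ₗ[k] k)
    (l b t : S) (u v : S × S) : binPolarForm τ l b t u v = binPolarForm τ l b t v u := by
  rw [binPolarForm_apply, binPolar_comm, binPolarForm_apply]

lemma card_le_finrank_of_binPolarForm_pos {R : Type*} [CommRing R] [Algebra ℝ R]
    [FiniteDimensional ℝ R] (τ : R →ₗ[ℝ] ℝ) (l b t μ : R) (hμ : μ ^ 2 + b * μ + t = 0)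
    {ι : Type*} [Fintype ι] (F : ι → R × R)
    (horth : ∀ i j, i ≠ j → binPolarForm τ l b t (F i) (F j) = 0)
    (hpos : ∀ i, 0 < binPolarForm τ l b t (F i) (F i)) :
    Fintype.card ι ≤ Module.finrank ℝ R := by
  let Φ : (ι → ℝ) × R →ₗ[ℝ] R × R :=
    (Fintype.linearCombination ℝ F).coprod
      (LinearMap.prod (LinearMap.mulLeft ℝ μ) LinearMap.id)
  have hiso : ∀ z, binPolarForm τ l b t (μ * z, z) (μ * z, z) = 0 := by
    intro z
    rw [binPolarForm_apply, show l * binPolar b t (μ * z, z) (μ * z, z) = 0 by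
      simp only [binPolar]; linear_combination 2 * l * z ^ 2 * hμ, map_zero]
  have hΦ : Function.Injective Φ := by
    rw [injective_iff_map_eq_zero]
    rintro ⟨c, z⟩ h
    have h1 : Fintype.linearCombination ℝ F c = (μ * (-z), -z) := by
      have : Fintype.linearCombination ℝ F c + (μ * z, z) = 0 := h
      rw [eq_neg_of_add_eq_zero_left this]
      simp
    have h2 := hiso (-z)
    rw [← h1, Fintype.linearCombination_apply] at h2
    have h3 : binPolarForm τ l b t (∑ i, c i • F i) (∑ i, c i • F i) =
        ∑ i, c i ^ 2 * binPolarForm τ l b t (F i) (F i) := by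
      classical
      rw [LinearMap.map_sum₂]
      refine Finset.sum_congr rfl fun i _ ↦ ?_
      rw [map_sum, Finset.sum_eq_single i]
      · simp; ring
      · intro j _ hj; simp [horth i j hj.symm]
      · simp
    rw [h3, Finset.sum_eq_zero_iff_of_nonneg fun i _ ↦ mul_nonneg (sq_nonneg _) (hpos i).le] at h2
    have h4 : c = 0 := by
      ext i
      simpa [(hpos i).ne'] using h2 i (Finset.mem_univ _)
    rw [h4, map_zero] at h1
    have h5 : z = 0 := by simpa using (congrArg Prod.snd h1).symm
    rw [h4, h5]; rfl
  have := LinearMap.finrank_le_finrank_of_injective hΦ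
  simp at this
  omega

open mixedEmbedding in
lemma trace_mixedEmbedding (K : Type*) [Field K] [NumberField K] (x : K) :
    Algebra.trace ℝ (mixedSpace K) (mixedEmbedding K x) = Algebra.trace ℚ K x := by
  classical
  rw [Algebra.trace_eq_matrix_trace (latticeBasis K),
    Algebra.trace_eq_matrix_trace (integralBasis K), Matrix.trace, Matrix.trace, Rat.cast_sum]
  refine Finset.sum_congr rfl fun i _ ↦ ?_
  rw [Matrix.diag_apply, Matrix.diag_apply, Algebra.leftMulMatrix_eq_repr_mul,
    Algebra.leftMulMatrix_eq_repr_mul, latticeBasis_apply, ← map_mul, latticeBasis_repr_apply]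

open mixedEmbedding InfinitePlace in
lemma exists_sq_eq_mixedEmbedding (K : Type*) [Field K] [NumberField K] (x : K)
    (hx : ∀ σ : K →+* ℝ, 0 < σ x) : ∃ ρ : mixedSpace K, ρ ^ 2 = mixedEmbedding K x := by
  choose f hf using fun w : {w : InfinitePlace K // IsComplex w} ↦
    IsAlgClosed.exists_pow_nat_eq ((mixedEmbedding K x).2 w) two_pos
  refine ⟨⟨fun w ↦ √((mixedEmbedding K x).1 w), f⟩, Prod.ext (funext fun w ↦ ?_) (funext hf)⟩
  rw [Prod.pow_fst, Pi.pow_apply, Real.sq_sqrt]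
  rw [mixedEmbedding_apply_isReal]
  exact (hx _).le

open mixedEmbedding in
theorem card_pos_eq_card_neg (K : Type*) [Field K] [NumberField K] (l b t : K)
    (hpos : ∀ σ : K →+* ℝ, 0 < σ (b ^ 2 - 4 * t)) {ι : Type*} [Fintype ι] [DecidableEq ι]
    (E : Module.Basis ι ℚ (K × K)) (A : ι → ℤ)
    (horth : ∀ i j, binPolarForm (Algebra.trace ℚ K) l b t (E i) (E j) =
      if i = j then 2 * (A i : ℚ) else 0) (hA : ∀ i, A i ≠ 0) :
    Fintype.card {i // 0 < A i} = Fintype.card {i // A i < 0} := by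
  obtain ⟨ρ, hρ⟩ := exists_sq_eq_mixedEmbedding K _ hpos
  set f := mixedEmbedding K
  have hτ : ∀ i j, binPolarForm (Algebra.trace ℝ (mixedSpace K)) (f l) (f b) (f t)
      ((E i).map f f) ((E j).map f f) = if i = j then 2 * (A i : ℝ) else 0 := by
    intro i j
    rw [binPolarForm_apply, ← map_binPolar, ← map_mul, trace_mixedEmbedding, ← binPolarForm_apply,
      horth]
    split_ifs <;> simp
  have hμ : ((1 / 2 : ℝ) • (ρ - f b)) ^ 2 + f b * ((1 / 2 : ℝ) • (ρ - f b)) + f t = 0 := by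
    have h2 : (4 : ℝ) • (((1 / 2 : ℝ) • (ρ - f b)) ^ 2 + f b * ((1 / 2 : ℝ) • (ρ - f b)) + f t) =
        ρ ^ 2 - f (b ^ 2 - 4 * t) := by
      have h4 : ∀ x : mixedSpace K, (4 : ℝ) • x = 4 * x := fun x ↦ by
        rw [Algebra.smul_def, map_ofNat]
      have h2 : ∀ x : mixedSpace K, (2 : ℝ) • x = 2 * x := fun x ↦ by
        rw [Algebra.smul_def, map_ofNat]
      have e : ρ - f b = 2 * ((1 / 2 : ℝ) • (ρ - f b)) := by rw [← h2, smul_smul]; norm_num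
      generalize (1 / 2 : ℝ) • (ρ - f b) = y at *
      rw [h4, show ρ = 2 * y + f b by rw [← e]; ring]
      simp only [map_sub, map_pow, map_mul, map_ofNat]
      ring
    rw [hρ, sub_self] at h2
    exact (smul_eq_zero_iff_right (by norm_num)).mp h2
  have h1 := card_le_finrank_of_binPolarForm_pos (Algebra.trace ℝ (mixedSpace K)) (f l) (f b) (f t)
    _ hμ (fun i : {i // 0 < A i} ↦ (E i).map f f)
    (fun i j hij ↦ by rw [hτ, if_neg (Subtype.coe_ne_coe.mpr hij)])
    (fun i ↦ by rw [hτ, if_pos rfl]; have := i.2; positivity)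
  have h2 := card_le_finrank_of_binPolarForm_pos (Algebra.trace ℝ (mixedSpace K)) (-f l) (f b) (f t)
    _ hμ (fun i : {i // A i < 0} ↦ (E i).map f f)
    (fun i j hij ↦ by
      rw [binPolarForm_apply, neg_mul, map_neg, ← binPolarForm_apply, hτ,
        if_neg (Subtype.coe_ne_coe.mpr hij), neg_zero])
    (fun i ↦ by
      rw [binPolarForm_apply, neg_mul, map_neg, ← binPolarForm_apply, hτ, if_pos rfl]
      have : (A i : ℝ) < 0 := by exact_mod_cast i.2
      linarith)
  rw [mixedEmbedding.finrank] at h1 h2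
  have h3 := Module.finrank_eq_card_basis E
  rw [Module.finrank_prod] at h3
  have h4 := Fintype.card_subtype_compl (fun i ↦ 0 < A i)
  have h5 : Fintype.card {i // ¬ 0 < A i} = Fintype.card {i // A i < 0} :=
    Fintype.card_congr (Equiv.subtypeEquivRight fun i ↦ by
      have := hA i
      omega)
  have h6 := Fintype.card_subtype_le (fun i ↦ 0 < A i)
  omega
end Signature

section IntegralLattice
variable {K : Type*} [Field K] [NumberField K]

lemma mem_span_integralBasis_prod (x : K × K) :
    x ∈ Submodule.span ℤ (Set.range ((integralBasis K).prod (integralBasis K))) ↔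
      ∃ y : 𝓞 K × 𝓞 K, (y.1 : K) = x.1 ∧ (y.2 : K) = x.2 := by
  rw [Module.Basis.mem_span_iff_repr_mem, Sum.forall]
  simp only [Module.Basis.prod_repr_inl, Module.Basis.prod_repr_inr]
  rw [← Module.Basis.mem_span_iff_repr_mem, ← Module.Basis.mem_span_iff_repr_mem,
    mem_span_integralBasis, mem_span_integralBasis]
  simp [Prod.exists]

lemma nondegenerate_binPolarForm_trace (l b t : K) (hl : l ≠ 0) (hd : b ^ 2 - 4 * t ≠ 0) :
    (binPolarForm (Algebra.trace ℚ K) l b t).Nondegenerate := by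
  have tr : ∀ z : K, (∀ y, Algebra.trace ℚ K (l * (z * y)) = 0) → z = 0 := fun z hz ↦ by
    have := (traceForm_nondegenerate ℚ K).1 (l * z) fun y ↦ by
      rw [Algebra.traceForm_apply, mul_assoc, hz]
    simpa [hl] using this
  have hL : (binPolarForm (Algebra.trace ℚ K) l b t).SeparatingLeft := by
    intro u hu
    have h1 : 2 * u.1 + b * u.2 = 0 := tr _ fun y ↦ by
      rw [← hu (y, 0), binPolarForm_apply]; simp only [binPolar]; ring_nf
    have h2 : b * u.1 + 2 * t * u.2 = 0 := tr _ fun y ↦ by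
      rw [← hu (0, y), binPolarForm_apply]; simp only [binPolar]; ring_nf
    have h3 : u.2 = 0 := by
      have : (b ^ 2 - 4 * t) * u.2 = 0 := by linear_combination b * h1 - 2 * h2
      simpa [hd] using this
    have h4 : u.1 = 0 := by simpa [h3] using h1
    exact Prod.ext h4 h3
  refine ⟨hL, fun u hu ↦ hL u fun v ↦ ?_⟩
  rw [binPolarForm_comm, hu]

/-- The Gauss sum over `𝓞 K × 𝓞 K` of `l * (x² + bxy + ty²)`, where `b² - 4t` is totally positive
and the dual lattice is integral, is positive. -/
theorem integral_gauss_sum_pos (b t : 𝓞 K) (hpos : ∀ σ : K →+* ℝ, 0 < σ (b ^ 2 - 4 * t : 𝓞 K))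
    (hd : b ^ 2 - 4 * t ≠ 0) (l : K) (hl : l ≠ 0)
    (hH : ∀ x : K × K, (∀ y : 𝓞 K × 𝓞 K,
      ∃ n : ℤ, Algebra.trace ℚ K (l * binPolar (b : K) t x (y.1, y.2)) = n) →
        ∃ n : ℤ, Algebra.trace ℚ K (l * binForm (b : K) t x) = n)
    {B : Type*} [AddCommGroup B] [Fintype B] (π : 𝓞 K × 𝓞 K →+ B) (hπ : Function.Surjective π)
    (g : B → ℂ)
    (hg : ∀ y, g (π y) = ratExp (Algebra.trace ℚ K (l * (binForm b t y : 𝓞 K)))) :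
    ∃ r : ℝ, 0 < r ∧ ∑ y, g y = r := by
  classical
  set β := binPolarForm (Algebra.trace ℚ K) l (b : K) t with hβ
  have e4 : ((b ^ 2 - 4 * t : 𝓞 K) : K) = (b : K) ^ 2 - 4 * t := by
    simp only [map_sub, map_mul, map_pow, map_ofNat]
  have hd' : (b : K) ^ 2 - 4 * t ≠ 0 := by
    rw [← e4]
    exact fun h ↦ hd (RingOfIntegers.coe_injective h)
  have hnd : β.Nondegenerate := nondegenerate_binPolarForm_trace l b t hl hd'
  have hsymm : β.IsSymm := ⟨fun x y ↦ binPolarForm_comm _ _ _ _ _ _⟩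
  let bas := (integralBasis K).prod (integralBasis K)
  let L := Submodule.span ℤ (Set.range bas)
  let H := β.dualSubmodule L
  have hLH : β.dualSubmodule H = L := β.dualSubmodule_dualSubmodule_of_basis hnd hsymm bas
  have hone : ∀ x : ℚ, x ∈ (1 : Submodule ℤ ℚ) ↔ ∃ n : ℤ, x = n := fun x ↦ by
    simp [Submodule.mem_one, eq_comm]
  have hmemH : ∀ x, x ∈ H ↔ ∀ y : 𝓞 K × 𝓞 K,
      ∃ n : ℤ, Algebra.trace ℚ K (l * binPolar (b : K) t x (y.1, y.2)) = n := by
    intro x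
    constructor
    · intro hx y
      exact (hone _).mp (hx _ ((mem_span_integralBasis_prod _).mpr ⟨y, rfl, rfl⟩))
    · intro hx z hz
      obtain ⟨y, h1, h2⟩ := (mem_span_integralBasis_prod _).mp hz
      obtain rfl : ((y.1 : K), (y.2 : K)) = z := Prod.ext h1 h2
      exact (hone _).mpr (hx y)
  have hself : ∀ x, β x x = 2 * Algebra.trace ℚ K (l * binForm (b : K) t x) := by
    intro x
    rw [hβ, binPolarForm_apply, binPolar_self, mul_left_comm, two_mul, map_add, two_mul]
  have : Invertible (2 : ℚ) := invertibleOfNonzero two_ne_zero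
  obtain ⟨v, hv⟩ := LinearMap.BilinForm.exists_orthogonal_basis (B := β)
    (LinearMap.BilinForm.isSymm_iff.mp hsymm)
  have hscale : ∀ i, ∃ N : ℚ, N ≠ 0 ∧ N • v i ∈ H := by
    intro i
    obtain ⟨N, hN, hN'⟩ := exists_integral_multiples ℤ ℚ
      ({l * (v i).1, l * (v i).2} : Finset K)
    refine ⟨N, by exact_mod_cast hN, (hmemH _).mpr fun y ↦ ?_⟩
    have h1 : IsIntegral ℤ (N • (l * (v i).1)) := hN' _ (by simp)
    have h2 : IsIntegral ℤ (N • (l * (v i).2)) := hN' _ (by simp)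
    have h3 : IsIntegral ℤ (l * binPolar (b : K) t ((N : ℚ) • v i) (y.1, y.2)) := by
      have : l * binPolar (b : K) t ((N : ℚ) • v i) (y.1, y.2) =
          (N • (l * (v i).1)) * ((2 * y.1 + b * y.2 : 𝓞 K) : K) +
          (N • (l * (v i).2)) * ((b * y.1 + 2 * t * y.2 : 𝓞 K) : K) := by
        simp only [binPolar, Prod.smul_fst, Prod.smul_snd]
        simp only [Algebra.smul_def, map_add, map_mul, map_ofNat]
        simp
        ring
      rw [this]
      exact (h1.mul (RingOfIntegers.isIntegral_coe _)).add
        (h2.mul (RingOfIntegers.isIntegral_coe _))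
    obtain ⟨n, hn⟩ := IsIntegrallyClosed.isIntegral_iff.mp
      (Algebra.isIntegral_trace (L := ℚ) h3)
    exact ⟨n, by rw [← hn]; rfl⟩
  choose N hN hNH using hscale
  let E : Module.Basis _ ℚ (K × K) := v.unitsSMul fun i ↦ Units.mk0 (N i) (hN i)
  have hE : ∀ i, E i = N i • v i := fun i ↦ by
    rw [Module.Basis.unitsSMul_apply]; rfl
  have hEH : ∀ i, E i ∈ H := fun i ↦ by rw [hE]; exact hNH i
  have hEself : ∀ i, β (E i) (E i) ≠ 0 := fun i ↦ by
    rw [hE, map_smul, map_smul, LinearMap.smul_apply]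
    simpa [hN] using
      LinearMap.BilinForm.iIsOrtho.not_isOrtho_basis_self_of_nondegenerate hv hnd i
  have hHiso : ∀ x ∈ H, ∃ n : ℤ, β x x = 2 * n := by
    intro x hx
    obtain ⟨n, hn⟩ := hH x ((hmemH x).mp hx)
    exact ⟨n, by rw [hself, hn]⟩
  choose A hA using fun i ↦ hHiso _ (hEH i)
  have horth : ∀ i j, β (E i) (E j) = if i = j then 2 * (A i : ℚ) else 0 := by
    intro i j
    split_ifs with h
    · rw [← h, hA]
    · rw [hE, hE, map_smul, map_smul, LinearMap.smul_apply, show β (v i) (v j) = 0 from hv h]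
      simp
  have hA0 : ∀ i, A i ≠ 0 := fun i h ↦ hEself i (by rw [hA, h]; simp)
  have hsig := card_pos_eq_card_neg K l b t (by simpa only [e4] using hpos) E A horth hA0
  choose ψ hψ1 hψ2 using fun x : L ↦ (mem_span_integralBasis_prod x.1).mp x.2
  let Ψ : L.toAddSubgroup →+ 𝓞 K × 𝓞 K :=
    { toFun x := ψ x
      map_zero' := by
        ext <;> simp [hψ1, hψ2]
      map_add' x y := by
        ext <;> simp [hψ1, hψ2] }
  refine gauss_sum_pos β (fun x y ↦ binPolarForm_comm _ _ _ _ _ _) E A horth hA0 hsig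
    L.toAddSubgroup H.toAddSubgroup hHiso ?_ hEH (π.comp Ψ) ?_ g ?_
  · intro x
    rw [Submodule.mem_toAddSubgroup, ← hLH]
    exact forall₂_congr fun h _ ↦ hone _
  · intro z
    obtain ⟨y, rfl⟩ := hπ z
    refine ⟨⟨((y.1 : K), (y.2 : K)), (mem_span_integralBasis_prod _).mpr ⟨y, rfl, rfl⟩⟩, ?_⟩
    rw [AddMonoidHom.comp_apply]
    congr 1
    ext
    · exact hψ1 _
    · exact hψ2 _
  · intro x
    rw [AddMonoidHom.comp_apply, hg, hself, mul_div_cancel_left₀ _ two_ne_zero]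
    congr 3
    exact (map_binForm (algebraMap (𝓞 K) K) b t (ψ x)).trans
      (congrArg _ (Prod.ext (hψ1 _) (hψ2 _)))

end IntegralLattice

lemma binForm_add_smul {S : Type*} [CommRing S] (b t : S) (u e : S × S) (s : S) :
    binForm b t (u + s • e) = binForm b t u + s * binPolar b t u e + s ^ 2 * binForm b t e := by
  simp only [binPolar, binForm, Prod.fst_add, Prod.snd_add, Prod.smul_fst, Prod.smul_snd,
    smul_eq_mul]; ring

open Polynomial in
/-- Over a finite field, `x² + bxy + ty² = β ≠ 0` has a nonsingular solution, provided that `β` is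
a square when the discriminant vanishes. -/
lemma exists_binForm_eq_of_finite_field {k : Type*} [Field k] [Finite k] (b t β : k) (hβ : β ≠ 0)
    (h2 : (2 : k) = 0 → b ≠ 0) (hD : b ^ 2 - 4 * t = 0 → IsSquare β) :
    ∃ u e : k × k, binForm b t u = β ∧ binPolar b t u e = 1 := by
  have := Fintype.ofFinite k
  by_cases h : (2 : k) = 0
  · have hb := h2 h
    have hc : ringChar k = 2 := by
      have : CharP k 2 := CharTwo.of_one_ne_zero_of_two_eq_zero one_ne_zero h
      exact ringChar.eq k 2
    obtain ⟨x, hx⟩ := FiniteField.isSquare_of_char_two hc β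
    have hx0 : x ≠ 0 := by rintro rfl; simp [hx] at hβ
    refine ⟨(x, 0), (0, 1 / (b * x)), by simp [binForm, hx, sq], ?_⟩
    simp only [binPolar]
    field_simp
    simp
  · suffices ∃ u : k × k, binForm b t u = β by
      obtain ⟨u, hu⟩ := this
      refine ⟨u, (1 / (2 * β)) • u, hu, ?_⟩
      have : binPolar b t u ((1 / (2 * β)) • u) = 1 / (2 * β) * binPolar b t u u := by
        simp only [binPolar, Prod.smul_fst, Prod.smul_snd, smul_eq_mul]; ring
      rw [this, binPolar_self, hu]
      field_simp
    by_cases hd : b ^ 2 - 4 * t = 0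
    · obtain ⟨s, hs⟩ := hD hd
      exact ⟨(s, 0), by simp [binForm, hs, sq]⟩
    · have h4 : (4 : k) ≠ 0 := by
        rw [show (4 : k) = 2 * 2 by norm_num]; exact mul_ne_zero h h
      have hodd : Fintype.card k % 2 = 1 := by
        apply FiniteField.odd_card_of_char_ne_two
        intro hc
        apply h
        have := ringChar.Nat.cast_ringChar (R := k)
        rw [hc] at this
        exact_mod_cast this
      obtain ⟨x, y, hxy⟩ := FiniteField.exists_root_sum_quadratic
        (f := C 1 * X ^ 2 + C 0 * X + C (-β))
        (g := C (-(b ^ 2 - 4 * t) / 4) * X ^ 2 + C 0 * X + C 0)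
        (degree_quadratic one_ne_zero) (degree_quadratic (by
          rw [neg_div]; exact neg_ne_zero.mpr (div_ne_zero hd h4))) hodd
      refine ⟨(x - b * y / 2, y), ?_⟩
      simp only [binForm]
      simp at hxy
      have e : (4 * t - b ^ 2) / 4 = t - (b / 2) ^ 2 := by field_simp; ring
      rw [e] at hxy
      have hb : 2 * (b / 2) = b := by field_simp
      rw [mul_div_right_comm]
      linear_combination hxy - (x * y - b / 2 * y ^ 2) * hb

open Polynomial in
/-- A nonsingular solution of `x² + bxy + ty² = β` modulo every maximal ideal of a finite ring gives
a solution. -/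
lemma exists_binForm_eq_of_finite_ring {R : Type*} [CommRing R] [Finite R] (b t β : R)
    (h : ∀ M : Ideal R, M.IsMaximal →
      ∃ u e : R × R, binForm b t u - β ∈ M ∧ binPolar b t u e - 1 ∈ M) :
    ∃ u, binForm b t u = β := by
  choose! u e hu he using h
  have hcop : Pairwise (Function.onFun IsCoprime fun M : MaximalSpectrum R ↦ M.asIdeal) := by
    intro M N hMN
    exact Ideal.isCoprime_iff_sup_eq.mpr
      (Ideal.IsMaximal.coprime_of_ne M.isMaximal N.isMaximal fun h ↦ hMN (MaximalSpectrum.ext h))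
  obtain ⟨u₁, hu₁⟩ := Ideal.exists_forall_sub_mem_ideal hcop fun M ↦ (u M.asIdeal).1
  obtain ⟨u₂, hu₂⟩ := Ideal.exists_forall_sub_mem_ideal hcop fun M ↦ (u M.asIdeal).2
  obtain ⟨e₁, he₁⟩ := Ideal.exists_forall_sub_mem_ideal hcop fun M ↦ (e M.asIdeal).1
  obtain ⟨e₂, he₂⟩ := Ideal.exists_forall_sub_mem_ideal hcop fun M ↦ (e M.asIdeal).2
  have key1 : ∀ M : Ideal R, M.IsMaximal → binForm b t (u₁, u₂) - β ∈ M := by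
    intro M hM
    have h := hu M hM
    rw [← Ideal.Quotient.eq_zero_iff_mem, map_sub, map_binForm] at h ⊢
    rw [← h]
    have e1 := Ideal.Quotient.eq.mpr (hu₁ ⟨M, hM⟩)
    have e2 := Ideal.Quotient.eq.mpr (hu₂ ⟨M, hM⟩)
    simp only [Prod.map, e1, e2]
  have key2 : ∀ M : Ideal R, M.IsMaximal → binPolar b t (u₁, u₂) (e₁, e₂) - 1 ∈ M := by
    intro M hM
    have h := he M hM
    rw [← Ideal.Quotient.eq_zero_iff_mem, map_sub, map_binPolar] at h ⊢
    rw [← h]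
    have e1 := Ideal.Quotient.eq.mpr (hu₁ ⟨M, hM⟩)
    have e2 := Ideal.Quotient.eq.mpr (hu₂ ⟨M, hM⟩)
    have e3 := Ideal.Quotient.eq.mpr (he₁ ⟨M, hM⟩)
    have e4 := Ideal.Quotient.eq.mpr (he₂ ⟨M, hM⟩)
    simp only [Prod.map, e1, e2, e3, e4]
  have hnil : ∀ x : R, (∀ M : Ideal R, M.IsMaximal → x ∈ M) → IsNilpotent x := fun x hx ↦
    nilpotent_iff_mem_prime.mpr fun J hJ ↦ hx J ((IsArtinianRing.isPrime_iff_isMaximal J).mp hJ)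
  have n1 := hnil _ key1
  have n2 := hnil _ key2
  have hunit : IsUnit (binPolar b t (u₁, u₂) (e₁, e₂)) := by
    have := n2.isUnit_add_one
    rwa [sub_add_cancel] at this
  obtain ⟨s, ⟨-, hs⟩, -⟩ := Polynomial.existsUnique_nilpotent_sub_and_aeval_eq_zero
    (R := R) (S := R) (P := C (binForm b t (e₁, e₂)) * X ^ 2 + C (binPolar b t (u₁, u₂) (e₁, e₂)) * X
      + C (binForm b t (u₁, u₂) - β)) (x := 0) (by simpa using n1) (by simpa using hunit)
  refine ⟨(u₁, u₂) + s • (e₁, e₂), ?_⟩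
  rw [binForm_add_smul]
  simp at hs
  linear_combination hs

lemma sum_binForm_mul_eq {R A : Type*} [CommRing R] [Fintype R] [AddCommMonoid A]
    (b t : R) (u : R × R) (hu : IsUnit (binForm b t u)) (ψ : R → A) :
    ∑ y, ψ (binForm b t u * binForm b t y) = ∑ y, ψ (binForm b t y) := by
  obtain ⟨c, hc⟩ := hu.exists_left_inv
  let m : R × R → R × R := fun y ↦
    (u.1 * y.1 - t * u.2 * y.2, u.1 * y.2 + u.2 * y.1 + b * u.2 * y.2)
  have hm : Function.Injective m := by
    intro y z h
    simp only [m, Prod.mk.injEq] at h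
    simp only [binForm] at hc
    obtain ⟨h1, h2⟩ := h
    ext
    · linear_combination c * (u.1 + b * u.2) * h1 + c * t * u.2 * h2 - (y.1 - z.1) * hc
    · linear_combination -c * u.2 * h1 + c * u.1 * h2 - (y.2 - z.2) * hc
  rw [← (Finite.injective_iff_bijective.mp hm).sum_comp fun y ↦ ψ (binForm b t y)]
  refine Finset.sum_congr rfl fun y _ ↦ congrArg ψ ?_
  simp only [binForm, m]; ring

lemma sum_addChar_mul_sq {F : Type*} [Field F] [Fintype F] [DecidableEq F] (hF : ringChar F ≠ 2)
    (ψ : AddChar F ℂ) (hψ : ψ ≠ 1) (c : F) (hc : c ≠ 0) :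
    ∑ x, ψ (c * x ^ 2) =
      quadraticChar F c * gaussSum ((quadraticChar F).ringHomComp (Int.castRingHom ℂ)) ψ := by
  set χ := (quadraticChar F).ringHomComp (Int.castRingHom ℂ) with hχ
  have hχc : ∀ a, χ a = quadraticChar F a := fun a ↦ rfl
  have hprim := AddChar.IsPrimitive.of_ne_one hψ
  have h1 : ∑ x, ψ (c * x ^ 2) = ∑ a, (χ a + 1) * ψ (c * a) := by
    have : ∀ a, (χ a + 1) * ψ (c * a) = ∑ x with x ^ 2 = a, ψ (c * x ^ 2) := by
      intro a
      rw [Finset.sum_congr rfl (g := fun _ ↦ ψ (c * a))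
        (fun x hx ↦ by rw [(Finset.mem_filter.mp hx).2]), Finset.sum_const, nsmul_eq_mul]
      have := quadraticChar_card_sqrts hF a
      congr 1
      rw [hχc]
      norm_cast
      rw [← this]
      congr 2
      ext; simp
    simp_rw [this]
    rw [Finset.sum_fiberwise]
  rw [h1]
  simp_rw [add_mul, one_mul]
  rw [Finset.sum_add_distrib]
  have h2 : ∑ a, ψ (c * a) = 0 := by
    have := AddChar.sum_eq_zero_of_ne_one (hprim hc)
    simpa [AddChar.mulShift_apply] using this
  have h3 := gaussSum_mulShift χ ψ (Units.mk0 c hc)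
  have h4 : χ c * χ c = 1 := by
    rw [hχc, ← Int.cast_mul, ← sq, quadraticChar_sq_one hc, Int.cast_one]
  rw [h2, add_zero, ← h3, ← hχc, Units.val_mk0, ← mul_assoc, h4, one_mul]
  simp [gaussSum, AddChar.mulShift_apply]

lemma sum_addChar_binForm_of_not_isSquare {F : Type*} [Field F] [Fintype F] (h2 : (2 : F) ≠ 0)
    (ψ : AddChar F ℂ) (hψ : ψ ≠ 1) (b t : F) (hD : ¬ IsSquare (b ^ 2 - 4 * t)) :
    ∑ y, ψ (binForm b t y) = -Fintype.card F := by
  classical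
  have hF : ringChar F ≠ 2 := by
    intro hc
    apply h2
    have := ringChar.Nat.cast_ringChar (R := F)
    rw [hc] at this
    exact_mod_cast this
  have h4 : (4 : F) ≠ 0 := by
    rw [show (4 : F) = 2 * 2 by norm_num]; exact mul_ne_zero h2 h2
  have hD0 : b ^ 2 - 4 * t ≠ 0 := fun h ↦ hD (h ▸ IsSquare.zero)
  have hc : -((b ^ 2 - 4 * t) / 4) ≠ 0 := neg_ne_zero.mpr (div_ne_zero hD0 h4)
  have hbin : ∀ x y : F, ψ (binForm b t (x - b / 2 * y, y)) =
      ψ (1 * x ^ 2) * ψ (-((b ^ 2 - 4 * t) / 4) * y ^ 2) := by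
    intro x y
    rw [← AddChar.map_add_eq_mul]
    congr 1
    simp only [binForm]
    field_simp
    ring
  rw [Fintype.sum_prod_type_right]
  have : ∀ y, ∑ x, ψ (binForm b t (x, y)) =
      ∑ x, ψ (1 * x ^ 2) * ψ (-((b ^ 2 - 4 * t) / 4) * y ^ 2) := by
    intro y
    rw [← (Equiv.subRight (b / 2 * y)).sum_comp]
    exact Finset.sum_congr rfl fun x _ ↦ hbin x y
  simp_rw [this, ← Finset.sum_mul, ← Finset.mul_sum]
  rw [sum_addChar_mul_sq hF ψ hψ _ one_ne_zero, sum_addChar_mul_sq hF ψ hψ _ hc]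
  set χ := (quadraticChar F).ringHomComp (Int.castRingHom ℂ) with hχ
  have hχ1 : χ ≠ 1 := by
    intro h
    obtain ⟨a, ha⟩ := quadraticChar_exists_neg_one' hF
    have := congrArg (fun f : MulChar F ℂ ↦ f a) h
    simp [hχ, MulChar.ringHomComp_apply, ha] at this
    norm_num at this
  have hχ2 : χ.IsQuadratic := (quadraticChar_isQuadratic F).comp _
  have hG := gaussSum_sq hχ1 hχ2 (AddChar.IsPrimitive.of_ne_one hψ)
  have e1 : quadraticChar F (-((b ^ 2 - 4 * t) / 4)) = quadraticChar F (-1) * (-1) := by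
    rw [neg_eq_neg_one_mul, map_mul]
    congr 1
    rw [← quadraticChar_neg_one_iff_not_isSquare] at hD
    rw [← hD, show (b ^ 2 - 4 * t) = (b ^ 2 - 4 * t) / 4 * 2 ^ 2 by field_simp; norm_num,
      map_mul, quadraticChar_sq_one' h2, mul_one]
    congr 1; field_simp; norm_num
  have e2 : χ (-1) = quadraticChar F (-1) := rfl
  have e3 : ((quadraticChar F (-1) : ℤ) : ℂ) * quadraticChar F (-1) = 1 := by
    rw [← Int.cast_mul, ← sq, quadraticChar_sq_one (neg_ne_zero.mpr one_ne_zero), Int.cast_one]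
  rw [e1, map_one]
  push_cast
  rw [e2] at hG
  linear_combination (-(quadraticChar F (-1) : ℂ)) * hG - (Fintype.card F : ℂ) * e3

section Different
open nonZeroDivisors

/-- A multiple of the trace form whose dual lattice is integral up to a factor `d` prime to `p`. -/
lemma exists_trace_dual {K : Type*} [Field K] [NumberField K] (p : 𝓞 K) (hp : Prime p) :
    ∃ (c : K) (d : 𝓞 K), c ≠ 0 ∧ ¬ p ∣ d ∧
      (∀ z : 𝓞 K, ∃ n : ℤ, Algebra.trace ℚ K (c * z) = n) ∧
      ∀ z : K, (∀ y : 𝓞 K, ∃ n : ℤ, Algebra.trace ℚ K (c * z * y) = n) →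
        ∃ w : 𝓞 K, (w : K) = d * z := by
  set I : FractionalIdeal (𝓞 K)⁰ K := FractionalIdeal.dual ℤ ℚ 1 with hI
  have hI0 : I ≠ 0 := FractionalIdeal.dual_ne_zero ℤ ℚ (one_ne_zero (α := FractionalIdeal (𝓞 K)⁰ K))
  have hmem : ∀ x : K, x ∈ I ↔ ∀ y : 𝓞 K, ∃ n : ℤ, Algebra.trace ℚ K (x * y) = n := by
    intro x
    rw [hI, FractionalIdeal.mem_dual (one_ne_zero (α := FractionalIdeal (𝓞 K)⁰ K))]
    constructor
    · intro h y
      obtain ⟨n, hn⟩ := h y ((FractionalIdeal.mem_one_iff _).mpr ⟨y, rfl⟩)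
      exact ⟨n, by rw [Algebra.traceForm_apply] at hn; rw [← hn]; simp⟩
    · intro h y hy
      obtain ⟨y, rfl⟩ := (FractionalIdeal.mem_one_iff _).mp hy
      obtain ⟨n, hn⟩ := h y
      exact ⟨n, by rw [Algebra.traceForm_apply]; simpa using hn.symm⟩
  have hpK : (p : K) ≠ 0 := by simpa using hp.ne_zero
  obtain ⟨c, hcI, hc⟩ : ∃ c ∈ I, c / p ∉ I := by
    by_contra! h
    have h1 : FractionalIdeal.spanSingleton (𝓞 K)⁰ (p : K)⁻¹ * I ≤ I := by
      rw [FractionalIdeal.spanSingleton_mul_le_iff]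
      intro z hz
      rw [mul_comm, ← div_eq_mul_inv]
      exact h z hz
    have h2 := mul_le_mul_left h1 I⁻¹
    rw [mul_assoc, mul_inv_cancel₀ hI0, mul_one, FractionalIdeal.spanSingleton_le_iff_mem,
      FractionalIdeal.mem_one_iff] at h2
    obtain ⟨w, hw⟩ := h2
    apply hp.not_isUnit
    refine IsUnit.of_mul_eq_one w (RingOfIntegers.coe_injective ?_)
    rw [map_mul, map_one]
    change (p : K) * algebraMap (𝓞 K) K w = 1
    rw [hw, mul_inv_cancel₀ hpK]
  have hc0 : c ≠ 0 := by
    rintro rfl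
    exact hc (by simpa using hcI)
  obtain ⟨i, hi, hci⟩ : ∃ i ∈ I⁻¹, ¬ ∃ w : 𝓞 K, c / p * i = w := by
    by_contra! h
    apply hc
    rw [← inv_inv I, FractionalIdeal.mem_inv_iff (inv_ne_zero hI0)]
    intro y hy
    obtain ⟨w, hw⟩ := h y hy
    exact (FractionalIdeal.mem_one_iff _).mpr ⟨w, hw.symm⟩
  rw [FractionalIdeal.mem_inv_iff hI0] at hi
  obtain ⟨d, hd⟩ := (FractionalIdeal.mem_one_iff _).mp (hi c hcI)
  refine ⟨c, d, hc0, ?_, fun z ↦ (hmem c).mp hcI z, fun z hz ↦ ?_⟩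
  · rintro ⟨w, rfl⟩
    refine hci ⟨w, ?_⟩
    have : (p : K) * w = i * c := by rw [← hd, map_mul]
    field_simp
    linear_combination -this
  · obtain ⟨w, hw⟩ := (FractionalIdeal.mem_one_iff _).mp (hi _ ((hmem (c * z)).mpr hz))
    refine ⟨w, ?_⟩
    rw [show (w : K) = algebraMap (𝓞 K) K w from rfl, hw]
    rw [show (d : K) = algebraMap (𝓞 K) K d from rfl, hd]
    ring

lemma trace_binForm_of_mem_dual {K : Type*} [Field K] [NumberField K] (c : K) (d : 𝓞 K)
    (hd0 : d ≠ 0)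
    (hc : ∀ z : 𝓞 K, ∃ n : ℤ, Algebra.trace ℚ K (c * z) = n)
    (hd : ∀ z : K, (∀ y : 𝓞 K, ∃ n : ℤ, Algebra.trace ℚ K (c * z * y) = n) →
        ∃ w : 𝓞 K, (w : K) = d * z)
    (b t e : 𝓞 K) (he : e ≠ 0) (hbt : b ^ 2 - 4 * t ≠ 0) (x : K × K)
    (hx : ∀ y : 𝓞 K × 𝓞 K, ∃ n : ℤ, Algebra.trace ℚ K
      (c / ((d * (b ^ 2 - 4 * t) : 𝓞 K) ^ 2 * e) * binPolar (b : K) t x (y.1, y.2)) = n) :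
    ∃ n : ℤ, Algebra.trace ℚ K
      (c / ((d * (b ^ 2 - 4 * t) : 𝓞 K) ^ 2 * e) * binForm (b : K) t x) = n := by
  set D : 𝓞 K := b ^ 2 - 4 * t with hD
  have hDK : (D : K) ≠ 0 := by simpa using hbt
  have heK : (e : K) ≠ 0 := by simpa using he
  have hdK : (d : K) ≠ 0 := by simpa using hd0
  have hDe : (D : K) = b ^ 2 - 4 * t := by
    rw [hD]; simp only [map_sub, map_mul, map_pow, map_ofNat]
  rw [show ((d * D : 𝓞 K) : K) = d * D from map_mul _ _ _] at hx ⊢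
  set a : K := ((d : K) * D) ^ 2 * e with ha
  have ha0 : a ≠ 0 := mul_ne_zero (pow_ne_zero 2 (mul_ne_zero hdK hDK)) heK
  obtain ⟨w₁, h₁⟩ := hd ((2 * x.1 + b * x.2) / a) fun y ↦ by
    obtain ⟨n, hn⟩ := hx (y, 0)
    refine ⟨n, ?_⟩
    rw [← hn]; congr 1; simp only [binPolar, map_zero]; field_simp; ring
  obtain ⟨w₂, h₂⟩ := hd ((b * x.1 + 2 * t * x.2) / a) fun y ↦ by
    obtain ⟨n, hn⟩ := hx (0, y)
    refine ⟨n, ?_⟩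
    rw [← hn]; congr 1; simp only [binPolar, map_zero]; field_simp; ring
  have e₁ : x.1 = d * D * e * (b * w₂ - 2 * t * w₁) := by
    rw [h₁, h₂, ha]; field_simp; rw [hDe]; ring
  have e₂ : x.2 = d * D * e * (b * w₁ - 2 * w₂) := by
    rw [h₁, h₂, ha]; field_simp; rw [hDe]; ring
  obtain ⟨n, hn⟩ := hc (e * binForm b t (b * w₂ - 2 * t * w₁, b * w₁ - 2 * w₂))
  refine ⟨n, ?_⟩
  rw [← hn]
  congr 1
  change _ = c * algebraMap (𝓞 K) K _
  rw [map_mul, map_binForm]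
  simp only [binForm, Prod.map, e₁, e₂, map_sub, map_mul, map_ofNat]
  rw [ha]; field_simp
end Different

section Reciprocity
open nonZeroDivisors
variable {K : Type*} [Field K] [NumberField K]

/-- The character `z ↦ exp(2πi tr(c z / m))` of `𝓞 K / m`. -/
lemma exists_addChar_quotient (c : K) (m : 𝓞 K) (hm : m ≠ 0)
    (hc : ∀ z : 𝓞 K, ∃ n : ℤ, Algebra.trace ℚ K (c * z) = n) :
    ∃ ψ : AddChar (𝓞 K ⧸ Ideal.span {m}) ℂ, ∀ z : 𝓞 K,
      ψ (Ideal.Quotient.mk _ z) = ratExp (Algebra.trace ℚ K (c / m * z)) := by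
  have hmK : (m : K) ≠ 0 := by simpa using hm
  let φ : 𝓞 K → ℂ := fun z ↦ ratExp (Algebra.trace ℚ K (c / m * z))
  have hφ : ∀ z z', Ideal.Quotient.mk (Ideal.span {m}) z = Ideal.Quotient.mk _ z' → φ z = φ z' := by
    intro z z' h
    obtain ⟨w, hw⟩ := Ideal.mem_span_singleton.mp (Ideal.Quotient.eq.mp h)
    obtain ⟨n, hn⟩ := hc w
    refine ratExp_congr n ?_
    rw [← hn, ← map_add]
    congr 1
    have : (z : K) = z' + m * w := by
      rw [eq_add_of_sub_eq' hw]; simp only [map_add, map_mul]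
    rw [this]; field_simp
  have hout : ∀ z, φ (Quotient.out (Ideal.Quotient.mk (Ideal.span {m}) z)) = φ z := fun z ↦
    hφ _ _ (Ideal.Quotient.mk_out _)
  refine ⟨⟨fun x ↦ φ (Quotient.out x), ?_, ?_⟩, hout⟩
  · rw [← map_zero (Ideal.Quotient.mk (Ideal.span {m})), hout]
    simp [φ, ratExp_zero]
  · intro x y
    obtain ⟨x, rfl⟩ := Ideal.Quotient.mk_surjective x
    obtain ⟨y, rfl⟩ := Ideal.Quotient.mk_surjective y
    rw [← map_add, hout, hout, hout]
    simp only [φ, map_add, mul_add, ratExp_add]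

lemma isMaximal_span_of_prime {p : 𝓞 K} (hp : Prime p) : (Ideal.span {p}).IsMaximal :=
  ((Ideal.span_singleton_prime hp.ne_zero).mpr hp).isMaximal
    (by simpa [Ideal.span_singleton_eq_bot] using hp.ne_zero)

lemma exists_mul_add_mul_eq_one {p x : 𝓞 K} (hp : Prime p) (hx : ¬ p ∣ x) :
    ∃ y z, y * x + z * p = 1 := by
  obtain ⟨y, i, hi, h⟩ := (isMaximal_span_of_prime hp).exists_inv
    (mt Ideal.mem_span_singleton.mp hx)
  obtain ⟨z, rfl⟩ := Ideal.mem_span_singleton.mp hi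
  exact ⟨y, z, by rw [← h]; ring⟩

/-- One direction of quadratic reciprocity over a number field: `p₁` is assumed totally positive
and a discriminant (so, a square modulo `4`). -/
theorem exists_dvd_sub_sq (p₁ p₂ b t : 𝓞 K) (hp₁ : Prime p₁) (hp₂ : Prime p₂)
    (h₁₂ : ¬ p₂ ∣ p₁) (hbt : b ^ 2 - 4 * t = p₁)
    (hpos : ∀ σ : K →+* ℝ, 0 < σ p₁) (h₁ : ¬ p₁ ∣ 2) (h₂ : ¬ p₂ ∣ 2)
    (hsq : ∃ r, p₁ ∣ p₂ - r ^ 2) : ∃ s, p₂ ∣ p₁ - s ^ 2 := by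
  obtain ⟨c, d, hc0, hpd, hc, hd⟩ := exists_trace_dual p₂ hp₂
  have hd0 : d ≠ 0 := by rintro rfl; exact hpd (dvd_zero _)
  set κ : 𝓞 K := (d * p₁) ^ 2 with hκ
  have hκ0 : κ ≠ 0 := pow_ne_zero 2 (mul_ne_zero hd0 hp₁.ne_zero)
  have hpκ : ¬ p₂ ∣ κ := fun h ↦ (hp₂.dvd_or_dvd (hp₂.dvd_of_dvd_pow h)).elim hpd h₁₂
  obtain ⟨α, β, hαβ⟩ := exists_mul_add_mul_eq_one hp₂ hpκ
  have hκK : (κ : K) ≠ 0 := by simpa using hκ0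
  have hp₂K : (p₂ : K) ≠ 0 := by simpa using hp₂.ne_zero
  have hαβK : (α : K) * κ + β * p₂ = 1 := by
    have := congrArg (algebraMap (𝓞 K) K) hαβ
    simpa only [map_add, map_mul, map_one] using this
  have hmax := isMaximal_span_of_prime hp₂
  let F := 𝓞 K ⧸ Ideal.span {p₂}
  let R := 𝓞 K ⧸ Ideal.span {κ}
  let : Field F := Ideal.Quotient.field _
  have : Finite F := Ideal.finiteQuotientOfFreeOfNeBot _
    (by simpa [Ideal.span_singleton_eq_bot] using hp₂.ne_zero)
  have : Finite R := Ideal.finiteQuotientOfFreeOfNeBot _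
    (by simpa [Ideal.span_singleton_eq_bot] using hκ0)
  let := Fintype.ofFinite F
  let := Fintype.ofFinite R
  let f : 𝓞 K →+* F := Ideal.Quotient.mk _
  let g : 𝓞 K →+* R := Ideal.Quotient.mk _
  have hf : Function.Surjective f := Ideal.Quotient.mk_surjective
  have hg : Function.Surjective g := Ideal.Quotient.mk_surjective
  have hf0 : ∀ x, f x = 0 ↔ p₂ ∣ x := fun x ↦
    Ideal.Quotient.eq_zero_iff_mem.trans Ideal.mem_span_singleton
  have hg0 : g κ = 0 := Ideal.Quotient.eq_zero_iff_mem.mpr (Ideal.mem_span_singleton_self κ)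
  obtain ⟨ψ, hψ⟩ := exists_addChar_quotient c p₂ hp₂.ne_zero hc
  obtain ⟨χ, hχ⟩ := exists_addChar_quotient c κ hκ0 hc
  change ∀ z, ψ (f z) = _ at hψ
  change ∀ z, χ (g z) = _ at hχ
  have hfα : f α * f κ = 1 := by
    have := congrArg f hαβ
    rwa [map_add, map_mul, map_mul, (hf0 p₂).mpr dvd_rfl, mul_zero, add_zero, map_one] at this
  have hgβ : g β * g p₂ = 1 := by
    have := congrArg g hαβ
    rwa [map_add, map_mul, map_mul, hg0, mul_zero, zero_add, map_one] at this
  have hD0 : b ^ 2 - 4 * t ≠ 0 := hbt ▸ hp₁.ne_zero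
  have hκ' : κ = (d * (b ^ 2 - 4 * t)) ^ 2 := by rw [hbt]
  have hpos' : ∀ σ : K →+* ℝ, 0 < σ (b ^ 2 - 4 * t : 𝓞 K) := hbt ▸ hpos
  have hdD : ((d * (b ^ 2 - 4 * t) : 𝓞 K) : K) ≠ 0 :=
    RingOfIntegers.coe_ne_zero_iff.mpr (mul_ne_zero hd0 hD0)
  -- the sum modulo `κ`
  obtain ⟨r₁, hr₁, hT⟩ := integral_gauss_sum_pos b t hpos' hD0
    (c / ((d * (b ^ 2 - 4 * t) : 𝓞 K) ^ 2 * (1 : 𝓞 K)))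
    (div_ne_zero hc0 (mul_ne_zero (pow_ne_zero 2 hdD)
      (RingOfIntegers.coe_ne_zero_iff.mpr one_ne_zero)))
    (trace_binForm_of_mem_dual c d hd0 hc hd b t 1 one_ne_zero hD0)
    (B := R × R) (AddMonoidHom.prodMap (g : 𝓞 K →+ R) (g : 𝓞 K →+ R))
    (hg.prodMap hg) (fun y ↦ χ (binForm (g b) (g t) y)) (by
      intro y
      have : binForm (g b) (g t) (AddMonoidHom.prodMap (g : 𝓞 K →+ R) (g : 𝓞 K →+ R) y) =
        g (binForm b t y) := (map_binForm g b t y).symm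
      rw [this, hχ, hκ']
      simp only [map_mul, map_pow, map_one, mul_one])
  -- the sum modulo `κ p₂`
  let π : 𝓞 K × 𝓞 K →+ (F × F) × (R × R) :=
    (AddMonoidHom.prodMap (f : 𝓞 K →+ F) (f : 𝓞 K →+ F)).prod
      (AddMonoidHom.prodMap (g : 𝓞 K →+ R) (g : 𝓞 K →+ R))
  have hπ : Function.Surjective π := by
    have key : ∀ (x : F) (y : R), ∃ z, f z = x ∧ g z = y := by
      intro x y
      obtain ⟨x, rfl⟩ := hf x
      obtain ⟨y, rfl⟩ := hg y
      refine ⟨x * (α * κ) + y * (β * p₂), ?_, ?_⟩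
      · simp only [map_add, map_mul, hfα, (hf0 p₂).mpr dvd_rfl, mul_zero, add_zero, mul_one]
      · simp only [map_add, map_mul, hgβ, hg0, mul_zero, zero_add, mul_one]
    rintro ⟨⟨x₁, x₂⟩, y₁, y₂⟩
    obtain ⟨z₁, rfl, rfl⟩ := key x₁ y₁
    obtain ⟨z₂, rfl, rfl⟩ := key x₂ y₂
    exact ⟨(z₁, z₂), rfl⟩
  obtain ⟨r₂, hr₂, hS⟩ := integral_gauss_sum_pos b t hpos' hD0
    (c / ((d * (b ^ 2 - 4 * t) : 𝓞 K) ^ 2 * p₂))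
    (div_ne_zero hc0 (mul_ne_zero (pow_ne_zero 2 hdD) hp₂K))
    (trace_binForm_of_mem_dual c d hd0 hc hd b t p₂ hp₂.ne_zero hD0) π hπ
    (fun y ↦ ψ (f α * binForm (f b) (f t) y.1) * χ (g β * binForm (g b) (g t) y.2)) (by
      intro y
      have e₁ : binForm (f b) (f t) (π y).1 = f (binForm b t y) := (map_binForm f b t y).symm
      have e₂ : binForm (g b) (g t) (π y).2 = g (binForm b t y) := (map_binForm g b t y).symm
      rw [e₁, e₂, ← map_mul, ← map_mul, hψ, hχ, ← ratExp_add, ← map_add]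
      congr 2
      have : ((d * (b ^ 2 - 4 * t) : 𝓞 K) : K) ^ 2 = κ := by
        rw [hκ']; simp only [map_pow]
      rw [this]
      simp only [map_mul]
      field_simp
      linear_combination (algebraMap (𝓞 K) K (binForm b t y)) * hαβK)
  rw [Fintype.sum_prod_type] at hS
  simp_rw [← Finset.mul_sum] at hS
  rw [← Finset.sum_mul] at hS
  -- `β` is represented by the form modulo `κ`
  obtain ⟨r, hr⟩ := hsq
  obtain ⟨u, hu⟩ : ∃ u, binForm (g b) (g t) u = g β := by
    refine exists_binForm_eq_of_finite_ring _ _ _ fun M hM ↦ ?_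
    let : Field (R ⧸ M) := Ideal.Quotient.field M
    let q : R →+* R ⧸ M := Ideal.Quotient.mk M
    have hq : Function.Surjective q := Ideal.Quotient.mk_surjective
    have : Finite (R ⧸ M) := Finite.of_surjective q hq
    have hD : q (g b) ^ 2 - 4 * q (g t) = q (g p₁) := by
      rw [← hbt]; simp only [map_sub, map_mul, map_pow, map_ofNat]
    have hβ : q (g β) * q (g p₂) = 1 := by rw [← map_mul, hgβ, map_one]
    obtain ⟨u, e, hu, he⟩ := exists_binForm_eq_of_finite_field (q (g b)) (q (g t)) (q (g β))
      (left_ne_zero_of_mul_eq_one hβ) (by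
        intro h20 hb
        obtain ⟨y, z, hyz⟩ := exists_mul_add_mul_eq_one hp₁ h₁
        have h4 : (4 : R ⧸ M) = 0 := by rw [show (4 : R ⧸ M) = 2 * 2 by norm_num, h20, zero_mul]
        have h10 : q (g p₁) = 0 := by rw [← hD, hb, h4]; ring
        have := congrArg (fun x ↦ q (g x)) hyz
        simp only [map_add, map_mul, map_ofNat, h20, h10, mul_zero, add_zero, map_one] at this
        exact zero_ne_one this) (by
        intro h
        rw [hD] at h
        obtain ⟨w, hw⟩ := hr
        have := congrArg (fun x ↦ q (g x)) hw
        simp only [map_sub, map_mul, map_pow, h, zero_mul] at this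
        refine ⟨q (g β) * q (g r), ?_⟩
        linear_combination (-q (g β)) * hβ + q (g β) ^ 2 * this)
    obtain ⟨u, rfl⟩ := (hq.prodMap hq) u
    obtain ⟨e, rfl⟩ := (hq.prodMap hq) e
    refine ⟨u, e, ?_, ?_⟩
    · rw [← Ideal.Quotient.eq_zero_iff_mem, map_sub, sub_eq_zero, map_binForm]; exact hu
    · rw [← Ideal.Quotient.eq_zero_iff_mem, map_sub, map_one, sub_eq_zero, map_binPolar]; exact he
  have hTβ := sum_binForm_mul_eq (g b) (g t) u (hu ▸ IsUnit.of_mul_eq_one _ hgβ) χ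
  rw [hu] at hTβ
  rw [hTβ, hT] at hS
  by_contra! hns
  have hnsq : ¬ IsSquare (f b ^ 2 - 4 * f t) := by
    rintro ⟨s, hs⟩
    obtain ⟨s, rfl⟩ := hf s
    refine hns s ?_
    rw [← hf0, ← hbt]
    simp only [map_sub, map_mul, map_pow, map_ofNat]
    rw [hs]; ring
  let ψ' : AddChar F ℂ := ψ.mulShift (f α)
  have hψ' : ψ' ≠ 1 := by
    intro h
    have h1 : ∀ x, ψ x = 1 := by
      intro x
      have := DFunLike.congr_fun h (f κ * x)
      simpa [ψ', AddChar.mulShift_apply, ← mul_assoc, hfα] using this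
    obtain ⟨w, hw⟩ := hd (1 / p₂) fun y ↦ by
      have := h1 (f y)
      rw [hψ, ratExp_eq_one_iff] at this
      simpa [div_eq_mul_inv] using this
    apply hpd
    refine ⟨w, RingOfIntegers.coe_injective ?_⟩
    rw [map_mul]
    change (d : K) = p₂ * w
    rw [hw]; field_simp
  have h2F : (2 : F) ≠ 0 := by
    intro h
    apply h₂
    rw [← hf0, map_ofNat]; exact h
  have hSq : ∑ y, ψ (f α * binForm (f b) (f t) y) = -Fintype.card F :=
    sum_addChar_binForm_of_not_isSquare h2F ψ' hψ' (f b) (f t) hnsq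
  rw [hSq] at hS
  have hS' : (-(Fintype.card F : ℝ)) * r₁ = r₂ := by exact_mod_cast hS
  have : (0 : ℝ) ≤ Fintype.card F * r₁ := by positivity
  linarith
end Reciprocity

section Hensel
open Filter Topology

lemma Valued.tendsto_zero_of_le {R Γ₀ : Type*} [Ring R] [LinearOrderedCommGroupWithZero Γ₀]
    [Valued R Γ₀] {ι : Type*} {l : Filter ι} {f g : ι → R}
    (h : ∀ i, Valued.v (f i) ≤ Valued.v (g i)) (hg : Tendsto g l (𝓝 0)) : Tendsto f l (𝓝 0) := by
  rw [(Valued.hasBasis_nhds_zero R Γ₀).tendsto_right_iff] at hg ⊢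
  intro γ hγ
  filter_upwards [hg γ hγ] with i hi
  exact (Valuation.restrict_le_iff _ |>.mpr (h i)).trans_lt hi

lemma Valued.nonarchimedeanAddGroup (R Γ₀ : Type*) [Ring R] [LinearOrderedCommGroupWithZero Γ₀]
    [Valued R Γ₀] : NonarchimedeanAddGroup R where
  is_nonarchimedean U hU := by
    obtain ⟨γ, hγ⟩ := Valued.mem_nhds_zero.mp hU
    refine ⟨⟨(Valued.v : Valuation R Γ₀).restrict.ltAddSubgroup γ, ?_⟩, hγ⟩
    exact Valued.isOpen_ball R γ.1

/-- Newton's method for square roots in a complete valued field. -/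
lemma isSquare_of_valued_sub_sq_lt_one {L Γ₀ : Type*} [Field L]
    [LinearOrderedCommGroupWithZero Γ₀] [MulArchimedean Γ₀] [Valued L Γ₀] [CompleteSpace L]
    {a r : L} (h2 : Valued.v (2 : L) = 1) (hr : Valued.v r = 1) (h : Valued.v (a - r ^ 2) < 1) :
    IsSquare a := by
  have := Valued.nonarchimedeanAddGroup L Γ₀
  have h20 : (2 : L) ≠ 0 := by rintro h; simp [h] at h2
  let f : ℕ → L := fun n ↦ Nat.rec r (fun _ x ↦ x + (a - x ^ 2) / (2 * x)) n
  have hf : ∀ n, f (n + 1) = f n + (a - f n ^ 2) / (2 * f n) := fun n ↦ rfl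
  set z := a - r ^ 2 with hz
  have hinv : ∀ n, Valued.v (f n) = 1 ∧ Valued.v (a - f n ^ 2) ≤ Valued.v (z ^ (n + 1)) := by
    intro n
    induction n with
    | zero => exact ⟨hr, by simp [f, hz]⟩
    | succ n ih =>
      obtain ⟨ih1, ih2⟩ := ih
      have hfn : f n ≠ 0 := by rintro h; simp [h] at ih1
      have hlt : Valued.v (z ^ (n + 1)) < 1 := by
        rw [map_pow]; exact pow_lt_one₀ zero_le h n.succ_ne_zero
      have hle : Valued.v (z ^ (n + 1)) ≤ Valued.v z := by
        rw [map_pow]; exact pow_le_of_le_one zero_le h.le n.succ_ne_zero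
      have hq : Valued.v ((a - f n ^ 2) / (2 * f n)) = Valued.v (a - f n ^ 2) := by
        rw [map_div₀, map_mul, h2, ih1, mul_one, div_one]
      constructor
      · rw [hf, Valuation.map_add_eq_of_lt_left, ih1]
        rw [hq, ih1]
        exact ih2.trans_lt hlt
      · have : a - f (n + 1) ^ 2 = -((a - f n ^ 2) / (2 * f n)) ^ 2 := by
          rw [hf]; field_simp; ring
        rw [this, Valuation.map_neg, map_pow, hq, pow_succ z, map_mul, sq]
        exact mul_le_mul' ih2 (ih2.trans hle)
  have htend : Tendsto (fun n ↦ z ^ (n + 1)) atTop (𝓝 0) :=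
    (tendsto_add_atTop_iff_nat 1).mpr (Valued.tendsto_zero_pow_of_v_lt_one h)
  have h1 : Tendsto (fun n ↦ a - f n ^ 2) atTop (𝓝 0) :=
    Valued.tendsto_zero_of_le (fun n ↦ (hinv n).2) htend
  have hc : CauchySeq f := by
    apply NonarchimedeanAddGroup.cauchySeq_of_tendsto_sub_nhds_zero
    refine Valued.tendsto_zero_of_le (fun n ↦ ?_) htend
    rw [hf, add_sub_cancel_left, map_div₀, map_mul, h2, (hinv n).1, mul_one, div_one]
    exact (hinv n).2
  obtain ⟨x, hx⟩ := cauchySeq_tendsto_of_complete hc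
  have h3 := tendsto_nhds_unique h1 (tendsto_const_nhds.sub (hx.pow 2))
  exact ⟨x, by rw [← sq]; exact sub_eq_zero.mp h3.symm⟩
end Hensel

section Adic
variable {R : Type*} [CommRing R] [IsDedekindDomain R] (K : Type*) [Field K] [Algebra R K]
  [IsFractionRing R K] (v : HeightOneSpectrum R)

lemma valued_algebraMap_adicCompletion (x : R) :
    Valued.v (algebraMap R (v.adicCompletion K) x) = v.intValuation x := by
  rw [← v.valuation_of_algebraMap (K := K)]
  exact v.valuedAdicCompletion_eq_valuation' (algebraMap R K x)

lemma isSquare_adicCompletion_of_sub_sq_mem {a r : R} (h2 : (2 : R) ∉ v.asIdeal)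
    (ha : a ∉ v.asIdeal) (h : a - r ^ 2 ∈ v.asIdeal) :
    IsSquare (algebraMap R (v.adicCompletion K) a) := by
  have hr : r ∉ v.asIdeal := fun hr ↦ ha (by
    have := v.asIdeal.add_mem h (v.asIdeal.pow_mem_of_mem hr 2 two_pos)
    rwa [sub_add_cancel] at this)
  refine isSquare_of_valued_sub_sq_lt_one (r := algebraMap R (v.adicCompletion K) r) ?_ ?_ ?_
  · rw [← map_ofNat (algebraMap R (v.adicCompletion K)), valued_algebraMap_adicCompletion]
    exact HeightOneSpectrum.intValuation_eq_one_iff.mpr h2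
  · rw [valued_algebraMap_adicCompletion]
    exact HeightOneSpectrum.intValuation_eq_one_iff.mpr hr
  · rw [← map_pow, ← map_sub, valued_algebraMap_adicCompletion]
    exact (v.intValuation_lt_one_iff_mem _).mpr h

lemma exists_sub_sq_mem_pow_of_isSquare_adicCompletion {a : R}
    (h : IsSquare (algebraMap R (v.adicCompletion K) a)) (n : ℕ) :
    ∃ b : R, a - b ^ 2 ∈ v.asIdeal ^ n := by
  obtain ⟨w, hw⟩ := h
  obtain ⟨c, hc⟩ := v.valuation_surjective (K := K) (WithZero.exp (-(n : ℤ)))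
  have hvc : Valued.v (algebraMap K (v.adicCompletion K) c) = WithZero.exp (-(n : ℤ)) :=
    (v.valuedAdicCompletion_eq_valuation' c).trans hc
  have hn1 : WithZero.exp (-(n : ℤ)) ≤ 1 := by
    rw [← WithZero.exp_zero, WithZero.exp_le_exp]; omega
  have hw1 : Valued.v w ≤ 1 := by
    have : Valued.v w * Valued.v w ≤ 1 := by
      rw [← map_mul, ← hw, valued_algebraMap_adicCompletion]
      exact v.intValuation_le_one a
    by_contra! hlt
    exact absurd this (not_le.mpr (one_lt_mul'' hlt hlt))
  obtain ⟨k, hk⟩ : ∃ k : K,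
      Valued.v (algebraMap K (v.adicCompletion K) k - w) < WithZero.exp (-(n : ℤ)) := by
    have hne : Valued.v.restrict (algebraMap K (v.adicCompletion K) c) ≠ 0 := by
      rw [← zero_lt_iff, Valuation.restrict_pos_iff, hvc]
      exact WithZero.exp_pos
    have hmem : {y | Valued.v.restrict (y - w) < (Units.mk0 _ hne).1} ∈ nhds w :=
      Valued.mem_nhds.mpr ⟨Units.mk0 _ hne, subset_rfl⟩
    obtain ⟨y, hy, k, rfl⟩ := mem_closure_iff_nhds.mp
      (HeightOneSpectrum.denseRange_algebraMap v (K := K) w) _ hmem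
    exact ⟨k, by rw [← hvc]; exact (Valuation.restrict_lt_iff _).mp hy⟩
  have hk1 : v.valuation K k ≤ 1 := by
    have e : Valued.v (algebraMap K (v.adicCompletion K) k) = v.valuation K k :=
      v.valuedAdicCompletion_eq_valuation' k
    rw [← e, ← sub_add_cancel (algebraMap K (v.adicCompletion K) k) w]
    exact (Valuation.map_add _ _ _).trans (max_le (hk.le.trans hn1) hw1)
  obtain ⟨b, hb⟩ := v.exists_valuation_sub_lt_of_integer hk1
    (Units.mk0 (WithZero.exp (-(n : ℤ))) WithZero.exp_ne_zero)
  have hb' : Valued.v (algebraMap R (v.adicCompletion K) b - w) ≤ WithZero.exp (-(n : ℤ)) := by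
    have e : Valued.v (algebraMap K (v.adicCompletion K) (algebraMap R K b - k)) =
      v.valuation K (algebraMap R K b - k) := v.valuedAdicCompletion_eq_valuation' _
    rw [map_sub, ← IsScalarTower.algebraMap_apply] at e
    rw [← sub_add_sub_cancel _ (algebraMap K (v.adicCompletion K) k)]
    exact (Valuation.map_add _ _ _).trans (max_le (e.trans_le (le_of_lt hb)) hk.le)
  refine ⟨b, ?_⟩
  rw [← v.intValuation_le_pow_iff_mem, ← valued_algebraMap_adicCompletion K, map_sub, hw, map_pow,
    show w * w - algebraMap R (v.adicCompletion K) b ^ 2 =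
      -((algebraMap R (v.adicCompletion K) b - w) * (algebraMap R (v.adicCompletion K) b + w)) by
      ring, Valuation.map_neg, map_mul]
  refine (mul_le_mul' hb' ((Valuation.map_add _ _ _).trans (max_le ?_ hw1))).trans_eq (mul_one _)
  rw [valued_algebraMap_adicCompletion]
  exact v.intValuation_le_one b

/-- An element that is a square in all completions at the places dividing `m` is a square
modulo `m`. -/
lemma exists_dvd_sub_sq_of_isSquare_adicCompletion {a m : R} (hm : m ≠ 0)
    (h : ∀ v : HeightOneSpectrum R, m ∈ v.asIdeal →
      IsSquare (algebraMap R (v.adicCompletion K) a)) : ∃ b, m ∣ a - b ^ 2 := by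
  classical
  have hI : Ideal.span {m} ≠ ⊥ := by simpa [Ideal.span_singleton_eq_bot] using hm
  let E := quotientEquivPiFactors hI
  have key : ∀ P : (UniqueFactorizationMonoid.factors (Ideal.span {m})).toFinset,
      ∃ b : R, a - b ^ 2 ∈ (P : Ideal R) ^
        (Multiset.count ↑P (UniqueFactorizationMonoid.factors (Ideal.span {m}))) := by
    rintro ⟨P, hP⟩
    have hP := Multiset.mem_toFinset.mp hP
    have hprime := UniqueFactorizationMonoid.prime_of_factor P hP
    have hdvd := UniqueFactorizationMonoid.dvd_of_mem_factors hP
    let w : HeightOneSpectrum R := ⟨P, Ideal.isPrime_of_prime hprime, hprime.ne_zero⟩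
    exact exists_sub_sq_mem_pow_of_isSquare_adicCompletion K w
      (h w (Ideal.dvd_span_singleton.mp hdvd)) _
  choose b hb using key
  obtain ⟨c, hc⟩ := E.surjective fun P ↦ Ideal.Quotient.mk _ (b P)
  obtain ⟨c, rfl⟩ := Ideal.Quotient.mk_surjective c
  refine ⟨c, ?_⟩
  rw [← Ideal.mem_span_singleton, ← Ideal.Quotient.eq, map_pow]
  apply E.injective
  rw [map_pow, hc]
  funext P
  rw [Pi.pow_apply, ← map_pow]
  exact Ideal.Quotient.eq.mpr (hb P)
end Adic

lemma FiniteField.isSquare_or_isSquare_or_isSquare_mul {F : Type*} [Field F] [Finite F] (a b : F) :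
    IsSquare a ∨ IsSquare b ∨ IsSquare (a * b) := by
  classical
  have := Fintype.ofFinite F
  by_contra! h
  obtain ⟨ha, hb, hab⟩ := h
  rw [← quadraticChar_neg_one_iff_not_isSquare] at ha hb hab
  rw [map_mul, ha, hb] at hab
  norm_num at hab

/-- Let `p₁, p₂` be odd prime elements of `𝓞 K` with distinct places.  If `p₁` is totally
positive, `p₁` is a square in `K_v` for every `v` above `2`, and `p₂` is a square in
`K_{v_{p₁}}`, then for every finite place `v` of `K` at least one of `p₁`, `p₂`, `p₁p₂`
is a square in `K_v`; equivalently, `(x₀² − p₁x₁²)(x₀² − p₂x₁²)(x₀² − p₁p₂x₁²) = 0` has a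
nontrivial solution in `K_v` for every finite place `v`. -/
theorem forall_finite_place_isSquare_or_solution
    (K : Type*) [Field K] [NumberField K]
    (p₁ p₂ : 𝓞 K) (hp₁ : Prime p₁) (hp₂ : Prime p₂)
    (v₁ v₂ : HeightOneSpectrum (𝓞 K))
    (hv₁ : v₁.asIdeal = Ideal.span {p₁}) (hv₂ : v₂.asIdeal = Ideal.span {p₂})
    (hodd₁ : (2 : 𝓞 K) ∉ v₁.asIdeal) (hodd₂ : (2 : 𝓞 K) ∉ v₂.asIdeal)
    (hne : v₁ ≠ v₂)
    (hpos : ∀ σ : K →+* ℝ, 0 < σ (algebraMap (𝓞 K) K p₁))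
    (h2 : ∀ v : HeightOneSpectrum (𝓞 K), (2 : 𝓞 K) ∈ v.asIdeal →
      IsSquare (algebraMap (𝓞 K) (v.adicCompletion K) p₁))
    (hsq : IsSquare (algebraMap (𝓞 K) (v₁.adicCompletion K) p₂)) :
    ∀ v : HeightOneSpectrum (𝓞 K),
      (IsSquare (algebraMap (𝓞 K) (v.adicCompletion K) p₁) ∨
       IsSquare (algebraMap (𝓞 K) (v.adicCompletion K) p₂) ∨
       IsSquare (algebraMap (𝓞 K) (v.adicCompletion K) (p₁ * p₂))) ∧
      (∃ x₀ x₁ : v.adicCompletion K, ¬(x₀ = 0 ∧ x₁ = 0) ∧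
        (x₀ ^ 2 - algebraMap (𝓞 K) (v.adicCompletion K) p₁ * x₁ ^ 2) *
        (x₀ ^ 2 - algebraMap (𝓞 K) (v.adicCompletion K) p₂ * x₁ ^ 2) *
        (x₀ ^ 2 - algebraMap (𝓞 K) (v.adicCompletion K) (p₁ * p₂) * x₁ ^ 2) = 0) := by
  have hmem₁ : ∀ x, x ∈ v₁.asIdeal ↔ p₁ ∣ x := fun x ↦ by rw [hv₁, Ideal.mem_span_singleton]
  have hmem₂ : ∀ x, x ∈ v₂.asIdeal ↔ p₂ ∣ x := fun x ↦ by rw [hv₂, Ideal.mem_span_singleton]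
  have hmem : ∀ (w v : HeightOneSpectrum (𝓞 K)) (p : 𝓞 K), w.asIdeal = Ideal.span {p} →
      p ∈ v.asIdeal → v = w := by
    intro w v p hw hp
    refine (HeightOneSpectrum.ext (w.isMaximal.eq_of_le v.isPrime.ne_top ?_)).symm
    rw [hw, Ideal.span_le]
    simpa using hp
  have h₁₂ : ¬ p₂ ∣ p₁ := fun h ↦ hne (hmem v₁ v₂ p₁ hv₁ ((hmem₂ _).mpr h)).symm
  obtain ⟨b, t, hbt⟩ := exists_dvd_sub_sq_of_isSquare_adicCompletion K (a := p₁)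
    (m := (4 : 𝓞 K)) (by norm_num) fun v hv ↦ h2 v (by
      rw [show (4 : 𝓞 K) = 2 * 2 by norm_num] at hv
      exact (v.isPrime.mem_or_mem hv).elim id id)
  obtain ⟨r, hr⟩ := exists_sub_sq_mem_pow_of_isSquare_adicCompletion K v₁ hsq 1
  rw [pow_one, hmem₁] at hr
  obtain ⟨s, hs⟩ := exists_dvd_sub_sq p₁ p₂ b (-t) hp₁ hp₂ h₁₂ (by linear_combination -hbt) hpos
    (mt (hmem₁ _).mpr hodd₁) (mt (hmem₂ _).mpr hodd₂) ⟨r, hr⟩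
  intro v
  have main : IsSquare (algebraMap (𝓞 K) (v.adicCompletion K) p₁) ∨
      IsSquare (algebraMap (𝓞 K) (v.adicCompletion K) p₂) ∨
      IsSquare (algebraMap (𝓞 K) (v.adicCompletion K) (p₁ * p₂)) := by
    by_cases h2v : (2 : 𝓞 K) ∈ v.asIdeal
    · exact Or.inl (h2 v h2v)
    by_cases h1v : p₁ ∈ v.asIdeal
    · obtain rfl := hmem v₁ v p₁ hv₁ h1v
      exact Or.inr (Or.inl hsq)
    by_cases hpv : p₂ ∈ v.asIdeal
    · obtain rfl := hmem v₂ v p₂ hv₂ hpv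
      exact Or.inl (isSquare_adicCompletion_of_sub_sq_mem K v h2v h1v ((hmem₂ _).mpr hs))
    have hmax := v.isMaximal
    let : Field (𝓞 K ⧸ v.asIdeal) := Ideal.Quotient.field _
    have lift : ∀ a : 𝓞 K, a ∉ v.asIdeal → IsSquare (Ideal.Quotient.mk v.asIdeal a) →
        IsSquare (algebraMap (𝓞 K) (v.adicCompletion K) a) := by
      rintro a ha ⟨x, hx⟩
      obtain ⟨x, rfl⟩ := Ideal.Quotient.mk_surjective x
      refine isSquare_adicCompletion_of_sub_sq_mem K v h2v ha (r := x) ?_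
      rw [← Ideal.Quotient.eq, hx, map_pow, sq]
    have h12v : p₁ * p₂ ∉ v.asIdeal := fun h ↦ (v.isPrime.mem_or_mem h).elim h1v hpv
    refine (FiniteField.isSquare_or_isSquare_or_isSquare_mul (Ideal.Quotient.mk v.asIdeal p₁)
      (Ideal.Quotient.mk v.asIdeal p₂)).imp (lift _ h1v) (Or.imp (lift _ hpv) fun h ↦ ?_)
    exact lift _ h12v (by rwa [map_mul])
  refine ⟨main, ?_⟩
  rcases main with ⟨x, hx⟩ | ⟨x, hx⟩ | ⟨x, hx⟩ <;>
  · refine ⟨x, 1, fun h ↦ one_ne_zero h.2, ?_⟩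
    rw [hx]; ring
end

section
/- Let p₄, p₅, p₆ ∈ 𝒪_K be odd prime elements with pairwise distinct associated places. Assume that p₅ is not a square in K_{v_{p₄}} and that p₆ is not a square in K_{v_{p₄}}. Then the polynomial g(x₀,x₁;y₀,y₁) = (x₀² − p₄x₁²)(x₀² − p₅x₁²)(x₀² − p₄p₅x₁²)(y₀² − p₆y₁²)(y₀³ − p₄y₁³) has no zero (x₀, x₁, y₀, y₁) with coordinates in K_{v_{p₄}} such that (x₀, x₁) ≠ (0,0) and (y₀, y₁) ≠ (0,0). -/
open NumberField IsDedekindDomain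

/-- If `c` is not an `n`-th power in a field, then `x ^ n - c * y ^ n` has only the trivial zero. -/
theorem pow_sub_mul_pow_ne_zero {F : Type*} [Field F] {n : ℕ} (hn : n ≠ 0) {c : F}
    (hc : ∀ z : F, z ^ n ≠ c) {x y : F} (hxy : ¬(x = 0 ∧ y = 0)) :
    x ^ n - c * y ^ n ≠ 0 := by
  intro h
  have hx : x ^ n = c * y ^ n := sub_eq_zero.mp h
  by_cases hy : y = 0
  · rw [hy, zero_pow hn, mul_zero] at hx
    exact hxy ⟨eq_zero_of_pow_eq_zero hx, hy⟩
  · refine hc (x / y) ?_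
    rw [div_pow, hx, mul_div_cancel_right₀ _ (pow_ne_zero n hy)]

open WithZero in
/-- An element of valuation `exp (-1)` is not an `n`-th power for `n ≠ 1`. -/
theorem pow_ne_of_valuation_eq_exp_neg_one {F : Type*} [Field F] (w : Valuation F ℤᵐ⁰) {n : ℕ}
    (hn : n ≠ 1) {c : F} (hc : w c = exp (-1 : ℤ)) (z : F) : z ^ n ≠ c := by
  intro h
  have hz : w z ^ n = exp (-1 : ℤ) := by rw [← map_pow, h, hc]
  have hlog := congrArg log hz
  rw [log_pow, log_exp, nsmul_eq_mul] at hlog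
  have hdvd : (n : ℤ) ∣ 1 := ⟨-log (w z), by linarith⟩
  exact hn (by exact_mod_cast Int.eq_one_of_dvd_one (by positivity) hdvd)

/-- A generator of the prime ideal of one place is a unit at any other place. -/
theorem valued_algebraMap_eq_one_of_ne {R : Type*} [CommRing R] [IsDedekindDomain R]
    (K : Type*) [Field K] [Algebra R K] [IsFractionRing R K] {v w : HeightOneSpectrum R}
    (hvw : v ≠ w) {p : R} (hw : w.asIdeal = Ideal.span {p}) :
    Valued.v (algebraMap R (v.adicCompletion K) p) = 1 := by
  have hp : p ∉ v.asIdeal := fun hmem => by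
    have hle : w.asIdeal ≤ v.asIdeal := by
      rwa [hw, Ideal.span_singleton_le_iff_mem]
    exact hvw (HeightOneSpectrum.ext
      (w.isMaximal.eq_of_le v.isPrime.ne_top hle).symm)
  exact (v.valuedAdicCompletion_eq_valuation p).trans (v.valuation_eq_one_iff_notMem.mpr hp)

/-- Let `p₄,p₅,p₆` be odd prime elements of `𝓞 K` with pairwise distinct places, and
suppose neither `p₅` nor `p₆` is a square in `K_{v_{p₄}}`.  Then the polynomial
`g = (x₀²−p₄x₁²)(x₀²−p₅x₁²)(x₀²−p₄p₅x₁²)(y₀²−p₆y₁²)(y₀³−p₄y₁³)` has no zero over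
`K_{v_{p₄}}` with `(x₀,x₁) ≠ (0,0)` and `(y₀,y₁) ≠ (0,0)`. -/
theorem no_local_zero_at_v4
    (K : Type*) [Field K] [NumberField K]
    (p₄ p₅ p₆ : 𝓞 K) (hp₄ : Prime p₄) (hp₅ : Prime p₅) (hp₆ : Prime p₆)
    (v₄ v₅ v₆ : HeightOneSpectrum (𝓞 K))
    (hv₄ : v₄.asIdeal = Ideal.span {p₄}) (hv₅ : v₅.asIdeal = Ideal.span {p₅})
    (hv₆ : v₆.asIdeal = Ideal.span {p₆})
    (hodd₄ : (2 : 𝓞 K) ∉ v₄.asIdeal) (hodd₅ : (2 : 𝓞 K) ∉ v₅.asIdeal)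
    (hodd₆ : (2 : 𝓞 K) ∉ v₆.asIdeal)
    (hne₄₅ : v₄ ≠ v₅) (hne₄₆ : v₄ ≠ v₆) (hne₅₆ : v₅ ≠ v₆)
    (hns₅ : ¬ IsSquare (algebraMap (𝓞 K) (v₄.adicCompletion K) p₅))
    (hns₆ : ¬ IsSquare (algebraMap (𝓞 K) (v₄.adicCompletion K) p₆)) :
    ∀ x₀ x₁ y₀ y₁ : v₄.adicCompletion K, ¬(x₀ = 0 ∧ x₁ = 0) → ¬(y₀ = 0 ∧ y₁ = 0) →
      (x₀ ^ 2 - algebraMap (𝓞 K) (v₄.adicCompletion K) p₄ * x₁ ^ 2) *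
      (x₀ ^ 2 - algebraMap (𝓞 K) (v₄.adicCompletion K) p₅ * x₁ ^ 2) *
      (x₀ ^ 2 - algebraMap (𝓞 K) (v₄.adicCompletion K) (p₄ * p₅) * x₁ ^ 2) *
      (y₀ ^ 2 - algebraMap (𝓞 K) (v₄.adicCompletion K) p₆ * y₁ ^ 2) *
      (y₀ ^ 3 - algebraMap (𝓞 K) (v₄.adicCompletion K) p₄ * y₁ ^ 3) ≠ 0 := by
  intro x₀ x₁ y₀ y₁ hx hy
  have hval₄ : Valued.v (algebraMap (𝓞 K) (v₄.adicCompletion K) p₄) = WithZero.exp (-1 : ℤ) := 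
    (v₄.valuedAdicCompletion_eq_valuation p₄).trans
      ((v₄.valuation_of_algebraMap p₄).trans (v₄.intValuation_singleton hp₄.ne_zero hv₄))
  have hval₅ : Valued.v (algebraMap (𝓞 K) (v₄.adicCompletion K) p₅) = 1 :=
    valued_algebraMap_eq_one_of_ne K hne₄₅ hv₅
  have hval₄₅ : Valued.v (algebraMap (𝓞 K) (v₄.adicCompletion K) (p₄ * p₅)) =
      WithZero.exp (-1 : ℤ) := by
    rw [map_mul, map_mul, hval₄, hval₅, mul_one]
  have hsq {c : v₄.adicCompletion K} (hc : ¬IsSquare c) (z : v₄.adicCompletion K) : z ^ 2 ≠ c :=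
    fun h => hc ⟨z, by rw [← h, sq]⟩
  refine mul_ne_zero (mul_ne_zero (mul_ne_zero (mul_ne_zero ?_ ?_) ?_) ?_) ?_
  · exact pow_sub_mul_pow_ne_zero two_ne_zero
      (pow_ne_of_valuation_eq_exp_neg_one _ (by norm_num) hval₄) hx
  · exact pow_sub_mul_pow_ne_zero two_ne_zero (hsq hns₅) hx
  · exact pow_sub_mul_pow_ne_zero two_ne_zero
      (pow_ne_of_valuation_eq_exp_neg_one _ (by norm_num) hval₄₅) hx
  · exact pow_sub_mul_pow_ne_zero two_ne_zero (hsq hns₆) hy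
  · exact pow_sub_mul_pow_ne_zero three_ne_zero
      (pow_ne_of_valuation_eq_exp_neg_one _ (by norm_num) hval₄) hy
end

section
/- There are no rational numbers x, y ∈ ℚ with y² = x³ − 16. Equivalently, the elliptic curve E over ℚ given by the Weierstrass equation y² = x³ − 16 has no affine rational points, so E(ℚ) consists only of the point at infinity. -/
namespace Zsqrtd

theorem isCoprime_mk_star {d a b : ℤ} (hab : IsCoprime a (d * b)) (hodd : Odd (a ^ 2 - d * b ^ 2)) :
    IsCoprime (⟨a, b⟩ : ℤ√d) ⟨a, -b⟩ := by
  obtain ⟨u, v, huv⟩ := hab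
  obtain ⟨k, hk⟩ := hodd
  refine ⟨⟨a - k * u, -b - k * v⟩, ⟨-k * u, k * v⟩, ?_⟩
  ext
  · simp only [re_add, re_mul, re_one]
    linear_combination hk - 2 * k * huv
  · simp only [im_add, im_mul, im_one]
    ring

/-- If `x² - d y²` is an odd cube, then `x + y √d` is a cube up to a unit. -/
theorem exists_unit_mul_cube {d x y w : ℤ} [IsDomain (ℤ√d)] [IsBezout (ℤ√d)]
    (hxy : IsCoprime x (d * y)) (h : x ^ 2 - d * y ^ 2 = w ^ 3) (hw : Odd (w ^ 3)) :
    ∃ a u : ℤ√d, IsUnit u ∧ (⟨x, y⟩ : ℤ√d) = u * a ^ 3 := by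
  have hmul : (⟨x, y⟩ : ℤ√d) * ⟨x, -y⟩ = (w : ℤ√d) ^ 3 := by
    rw [← Int.cast_pow, ← h]
    ext
    · simp only [re_mul, re_intCast]
      ring
    · simp only [im_mul, im_intCast]
      ring
  obtain ⟨a, u, hu⟩ := exists_associated_pow_of_mul_eq_pow'
    (isCoprime_mk_star hxy (h ▸ hw)) hmul
  exact ⟨a, u, u.isUnit, by rw [← hu, mul_comm]⟩

theorem norm_eq_zero_three {z : ℤ√3} : z.norm = 0 ↔ z = 0 := by
  refine norm_eq_zero (fun n hn => ?_) z
  have h₁ : n ≤ 2 := by nlinarith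
  have h₂ : -2 ≤ n := by nlinarith
  interval_cases n <;> omega

instance : IsDomain (ℤ√3) :=
  have : NoZeroDivisors (ℤ√3) := ⟨fun {a b} h => by
    have h' := norm_eq_zero_three.2 h
    rw [norm_mul, mul_eq_zero] at h'
    exact h'.imp norm_eq_zero_three.1 norm_eq_zero_three.1⟩
  NoZeroDivisors.to_isDomain _

theorem _root_.Int.exists_two_mul_abs_sub_mul_le (a : ℤ) {n : ℤ} (hn : n ≠ 0) :
    ∃ q : ℤ, 2 * |a - n * q| ≤ |n| := by
  refine ⟨round ((a : ℚ) / n), ?_⟩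
  have hn' : (n : ℚ) ≠ 0 := by exact_mod_cast hn
  have h := abs_sub_round ((a : ℚ) / n)
  set q := round ((a : ℚ) / n)
  have h' : (a : ℚ) - n * q = n * ((a : ℚ) / n - q) := by field_simp
  have : 2 * |(a : ℚ) - n * q| ≤ |(n : ℚ)| := by
    rw [h', abs_mul]
    nlinarith [abs_nonneg (n : ℚ)]
  exact_mod_cast this

theorem exists_natAbs_norm_sub_mul_lt (x : ℤ√3) {y : ℤ√3} (hy : y ≠ 0) :
    ∃ q : ℤ√3, (x - y * q).norm.natAbs < y.norm.natAbs := by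
  have hN : y.norm ≠ 0 := fun h => hy (norm_eq_zero_three.1 h)
  obtain ⟨p, hp⟩ := Int.exists_two_mul_abs_sub_mul_le (x * star y).re hN
  obtain ⟨q, hq⟩ := Int.exists_two_mul_abs_sub_mul_le (x * star y).im hN
  refine ⟨⟨p, q⟩, ?_⟩
  set r := (x * star y).re - y.norm * p with hr
  set s := (x * star y).im - y.norm * q with hs
  have key : (x - y * ⟨p, q⟩).norm * y.norm = r ^ 2 - 3 * s ^ 2 := by
    simp only [hr, hs, norm_def, re_sub, im_sub, re_mul, im_mul, re_star, im_star]
    ring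
  rw [← Int.ofNat_lt, Int.natCast_natAbs, Int.natCast_natAbs]
  have hpos : 0 < |y.norm| := abs_pos.2 hN
  refine lt_of_mul_lt_mul_right ?_ hpos.le
  rw [← abs_mul, key, abs_lt]
  have h₁ := sq_abs r
  have h₂ := sq_abs s
  have h₃ : 4 * |r| ^ 2 ≤ |y.norm| ^ 2 := by nlinarith [abs_nonneg r]
  have h₄ : 4 * |s| ^ 2 ≤ |y.norm| ^ 2 := by nlinarith [abs_nonneg s]
  constructor <;> nlinarith

instance : IsPrincipalIdealRing (ℤ√3) where
  principal I := by
    by_cases hI : I = ⊥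
    · subst hI
      infer_instance
    classical
    have hex : ∃ n : ℕ, ∃ y ∈ I, y ≠ 0 ∧ y.norm.natAbs = n := by
      obtain ⟨y, hy, hy0⟩ := Submodule.exists_mem_ne_zero_of_ne_bot hI
      exact ⟨_, y, hy, hy0, rfl⟩
    obtain ⟨y, hyI, hy0, hyn⟩ := Nat.find_spec hex
    refine ⟨y, _root_.le_antisymm (fun x hx => ?_) ?_⟩
    · obtain ⟨q, hq⟩ := exists_natAbs_norm_sub_mul_lt x hy0
      have hmem : x - y * q ∈ I := I.sub_mem hx (I.mul_mem_right _ hyI)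
      have h0 : x - y * q = 0 := by
        by_contra h
        exact Nat.find_min hex (hyn ▸ hq) ⟨_, hmem, h, rfl⟩
      exact Ideal.mem_span_singleton.2 ⟨q, sub_eq_zero.1 h0⟩
    · exact (Ideal.span_singleton_le_iff_mem I).2 hyI

theorem isFundamental_three :
    Pell.IsFundamental (Pell.Solution₁.mk 2 1 (by norm_num) : Pell.Solution₁ 3) := by
  refine ⟨by simp, by simp, fun {b} hb => ?_⟩
  rw [Pell.Solution₁.x_mk]
  omega

/-- The units of `ℤ[√3]` modulo cubes are generated by `2 + √3`. -/
theorem exists_unit_eq_cube_three {u : ℤ√3} (hu : IsUnit u) :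
    ∃ v : ℤ√3, IsUnit v ∧ (u = v ^ 3 ∨ u = ⟨2, 1⟩ * v ^ 3 ∨ u = ⟨2, -1⟩ * v ^ 3) := by
  have hnorm : u.norm = 1 := by
    rcases Int.natAbs_eq_iff.1 (norm_eq_one_iff.2 hu) with h | h
    · exact h
    · exfalso
      rw [norm_def] at h
      have h4 := congrArg (Int.cast : ℤ → ZMod 4) h
      push_cast at h4
      generalize (u.re : ZMod 4) = a at h4
      generalize (u.im : ZMod 4) = b at h4
      revert a b
      decide
  obtain ⟨n, hn⟩ := isFundamental_three.eq_zpow_or_neg_zpow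
    (⟨u, norm_eq_one_iff_mem_unitary.1 hnorm⟩ : Pell.Solution₁ 3)
  set U : Pell.Solution₁ 3 := ⟨u, norm_eq_one_iff_mem_unitary.1 hnorm⟩ with hU
  set ε : Pell.Solution₁ 3 := Pell.Solution₁.mk 2 1 (by norm_num) with hε
  have main : ∃ V : Pell.Solution₁ 3, U = V ^ 3 ∨ U = ε * V ^ 3 ∨ U = ε⁻¹ * V ^ 3 := by
    have hm : n = 3 * (n / 3) ∨ n = 1 + 3 * (n / 3) ∨ n = -1 + 3 * (n / 3 + 1) := by omega
    have hc (m : ℤ) : ε ^ (3 * m) = (ε ^ m) ^ 3 := by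
      rw [mul_comm, zpow_mul]
      norm_cast
    have hneg (V : Pell.Solution₁ 3) : (-V) ^ 3 = -V ^ 3 := Odd.neg_pow (by decide) V
    have hzpow : ∃ V : Pell.Solution₁ 3,
        ε ^ n = V ^ 3 ∨ ε ^ n = ε * V ^ 3 ∨ ε ^ n = ε⁻¹ * V ^ 3 := by
      rcases hm with h | h | h
      · exact ⟨ε ^ (n / 3), .inl (by rw [← hc, ← h])⟩
      · refine ⟨ε ^ (n / 3), .inr (.inl ?_)⟩
        rw [← hc, ← zpow_one_add, ← h]
      · refine ⟨ε ^ (n / 3 + 1), .inr (.inr ?_)⟩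
        rw [← hc, ← zpow_neg_one, ← zpow_add, ← h]
    obtain ⟨V, hV⟩ := hzpow
    rcases hn with h | h
    · exact ⟨V, by rwa [h]⟩
    · refine ⟨-V, ?_⟩
      rw [h, hneg, mul_neg, mul_neg, neg_inj, neg_inj, neg_inj]
      exact hV
  obtain ⟨V, hV⟩ := main
  have hVn : (V.1 : ℤ√3).norm = 1 := norm_eq_one_iff_mem_unitary.2 V.2
  refine ⟨V.1, norm_eq_one_iff.1 (by rw [hVn]; rfl), ?_⟩
  rcases hV with h | h | h
  · exact .inl (congrArg Subtype.val h)
  · exact .inr (.inl (congrArg Subtype.val h))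
  · exact .inr (.inr (congrArg Subtype.val h))

end Zsqrtd

theorem GaussianInt.exists_eq_cube_of_isUnit {u : GaussianInt} (hu : IsUnit u) :
    ∃ v : GaussianInt, u = v ^ 3 := by
  have h := (Zsqrtd.norm_eq_one_iff' (by norm_num) u).2 hu
  refine ⟨star u, ?_⟩
  obtain ⟨a, b⟩ := u
  rw [Zsqrtd.norm_def] at h
  simp only at h
  have ha : a ≤ 1 := by nlinarith [mul_self_nonneg a, mul_self_nonneg b]
  have ha' : -1 ≤ a := by nlinarith [mul_self_nonneg a, mul_self_nonneg b]
  have hb : b ≤ 1 := by nlinarith [mul_self_nonneg a, mul_self_nonneg b]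
  have hb' : -1 ≤ b := by nlinarith [mul_self_nonneg a, mul_self_nonneg b]
  interval_cases a <;> interval_cases b <;> first | omega | decide

/-- A primitive solution of `c² + d² = w³` with `w` odd comes from a cube in `ℤ[i]`. -/
theorem exists_of_sq_add_sq_eq_cube {c d w : ℤ} (hcd : IsCoprime c d) (h : c ^ 2 + d ^ 2 = w ^ 3)
    (hw : Odd (w ^ 3)) :
    ∃ a b : ℤ, c = a * (a ^ 2 - 3 * b ^ 2) ∧ d = b * (3 * a ^ 2 - b ^ 2) := by
  obtain ⟨a, u, hu, hau⟩ := Zsqrtd.exists_unit_mul_cube (d := -1) (x := c) (y := d) (w := w)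
    (by rw [neg_one_mul]; exact hcd.neg_right) (by rw [← h]; ring) hw
  obtain ⟨v, rfl⟩ := GaussianInt.exists_eq_cube_of_isUnit hu
  rw [← mul_pow] at hau
  generalize v * a = z at hau
  refine ⟨z.re, z.im, ?_, ?_⟩
  · rw [show c = (z ^ 3).re from congrArg Zsqrtd.re hau]
    simp only [pow_succ, pow_zero, one_mul, Zsqrtd.re_mul, Zsqrtd.im_mul]
    ring
  · rw [show d = (z ^ 3).im from congrArg Zsqrtd.im hau]
    simp only [pow_succ, pow_zero, one_mul, Zsqrtd.re_mul, Zsqrtd.im_mul]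
    ring

/-- The homogeneous space of the descent attached to the unit `2 + √3` has no `3`-adic point. -/
theorem not_isCoprime_of_twisted_cubic {c e r : ℤ}
    (h : c ^ 3 + 9 * c * e ^ 2 + 6 * c ^ 2 * e + 6 * e ^ 3 = 12 * r ^ 3) : ¬ IsCoprime c e := by
  intro hce
  have hc : (3 : ℤ) ∣ c := by
    refine Int.prime_three.dvd_of_dvd_pow (n := 3) ?_
    exact ⟨4 * r ^ 3 - 3 * c * e ^ 2 - 2 * c ^ 2 * e - 2 * e ^ 3, by linarith⟩
  obtain ⟨f, rfl⟩ := hc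
  have h9 : 9 * f ^ 3 + 18 * f ^ 2 * e + 9 * f * e ^ 2 + 2 * e ^ 3 = 4 * r ^ 3 := by linarith
  have he : (3 : ℤ) ∣ e := by
    have h' := congrArg (Int.cast : ℤ → ZMod 9) h9
    push_cast at h'
    rw [show (9 : ZMod 9) = 0 from rfl, show (18 : ZMod 9) = 0 from rfl] at h'
    simp only [zero_mul, zero_add] at h'
    have key : ∀ x y : ZMod 9, 2 * x ^ 3 = 4 * y ^ 3 → x ^ 3 = 0 := by decide
    have h0 := key _ _ h'
    have h0' : ((e ^ 3 : ℤ) : ZMod 9) = 0 := by exact_mod_cast h0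
    rw [ZMod.intCast_zmod_eq_zero_iff_dvd] at h0'
    exact Int.prime_three.dvd_of_dvd_pow (dvd_trans (by norm_num) h0')
  have := hce.isUnit_of_dvd' (dvd_mul_right 3 f) he
  exact absurd this Int.prime_three.not_isUnit

/-- A primitive solution of `a² - 3b² = s³` with `s` odd and `b = 12 r³` comes from a cube in
`ℤ[√3]`. -/
theorem exists_of_sq_sub_three_mul_sq_eq_cube {a b r s : ℤ} (hab : IsCoprime a (3 * b))
    (h : a ^ 2 - 3 * b ^ 2 = s ^ 3) (hs : Odd (s ^ 3)) (hb : b = 12 * r ^ 3) :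
    ∃ c e : ℤ, IsCoprime c e ∧ e * (c ^ 2 + e ^ 2) = 4 * r ^ 3 := by
  obtain ⟨y, u, hu, hyu⟩ := Zsqrtd.exists_unit_mul_cube hab h hs
  obtain ⟨v, -, hv⟩ := Zsqrtd.exists_unit_eq_cube_three hu
  have hcube (z : ℤ√3) : (z ^ 3).re = z.re ^ 3 + 9 * z.re * z.im ^ 2 ∧
      (z ^ 3).im = 3 * z.re ^ 2 * z.im + 3 * z.im ^ 3 := by
    simp only [pow_succ, pow_zero, one_mul, Zsqrtd.re_mul, Zsqrtd.im_mul]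
    constructor <;> ring
  have hz : ∃ z w : ℤ√3, (⟨a, b⟩ : ℤ√3) = w * z ^ 3 ∧ (w = 1 ∨ w = ⟨2, 1⟩ ∨ w = ⟨2, -1⟩) := by
    refine ⟨v * y, ?_⟩
    rcases hv with rfl | rfl | rfl
    · exact ⟨1, by rw [hyu]; ring, .inl rfl⟩
    · exact ⟨⟨2, 1⟩, by rw [hyu]; ring, .inr (.inl rfl)⟩
    · exact ⟨⟨2, -1⟩, by rw [hyu]; ring, .inr (.inr rfl)⟩
  obtain ⟨z, w, hzw, hw⟩ := hz
  obtain ⟨h₁, h₂⟩ := hcube z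
  have hre : a = w.re * (z ^ 3).re + 3 * w.im * (z ^ 3).im := by
    rw [← Zsqrtd.re_mul, ← hzw]
  have him : b = w.re * (z ^ 3).im + w.im * (z ^ 3).re := by
    rw [← Zsqrtd.im_mul, ← hzw]
  have hcop : IsCoprime z.re z.im := by
    obtain ⟨p, q, hpq⟩ := hab
    refine ⟨p * (w.re * (z.re ^ 2 + 9 * z.im ^ 2) + 9 * w.im * z.re * z.im) +
      q * (9 * w.re * z.re * z.im + 3 * w.im * (z.re ^ 2 + 9 * z.im ^ 2)),
      p * (9 * w.im * z.im ^ 2) + q * (9 * w.re * z.im ^ 2), ?_⟩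
    rw [← hpq, hre, him, h₁, h₂]
    ring
  rw [h₁, h₂, hb] at him
  rcases hw with rfl | rfl | rfl
  · refine ⟨z.re, z.im, hcop, ?_⟩
    simp only [Zsqrtd.re_one, Zsqrtd.im_one] at him
    linarith
  · exact absurd hcop (not_isCoprime_of_twisted_cubic (r := r) (by simp only at him; linarith))
  · refine absurd hcop.neg_left (not_isCoprime_of_twisted_cubic (r := r) ?_)
    simp only at him
    linarith

/-- Coprime integers whose product is a cube are both cubes. -/
theorem Int.exists_cubes_of_mul_eq_cube {m n z : ℤ} (h : m * n = z ^ 3) (hmn : IsCoprime m n) :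
    ∃ t s : ℤ, m = t ^ 3 ∧ n = s ^ 3 ∧ z = t * s := by
  obtain ⟨t, rfl⟩ := Int.eq_pow_of_mul_eq_pow_odd_left hmn (by decide) h
  obtain ⟨s, rfl⟩ := Int.eq_pow_of_mul_eq_pow_odd_right hmn (by decide) h
  refine ⟨t, s, rfl, rfl, ?_⟩
  rw [← mul_pow] at h
  exact ((show Odd 3 by decide).strictMono_pow.injective h).symm

/-- The first half of the descent: a `3`-isogeny, factoring over `ℤ[i]`. -/
theorem exists_dual_cubic_of_cubic {c d z : ℤ} (hcd : IsCoprime c d)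
    (h : d * (c ^ 2 + d ^ 2) = 4 * z ^ 3) :
    ∃ a b t s : ℤ, IsCoprime a b ∧ Odd a ∧ 4 ∣ b ∧ b * (3 * a ^ 2 - b ^ 2) = 4 * t ^ 3 ∧
      z = t * s := by
  have hpar : Odd c ∧ 4 ∣ d := by
    have hm := congrArg (Int.cast : ℤ → ZMod 4) h
    push_cast at hm
    rw [show (4 : ZMod 4) = 0 from rfl, zero_mul] at hm
    have key : ∀ x y : ZMod 4, y * (x ^ 2 + y ^ 2) = 0 → y = 0 ∨ (2 * x = 0 ∧ 2 * y = 0) := by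
      decide
    have hd : Even d → ¬ Even c := fun hd hc =>
      absurd (hcd.isUnit_of_dvd' hc.two_dvd hd.two_dvd) Int.prime_two.not_isUnit
    rcases key _ _ hm with h0 | ⟨h1, h2⟩
    · rw [ZMod.intCast_zmod_eq_zero_iff_dvd] at h0
      have h0' : (4 : ℤ) ∣ d := by exact_mod_cast h0
      exact ⟨Int.not_even_iff_odd.1 (hd (even_iff_two_dvd.2 (dvd_trans (by norm_num) h0'))), h0'⟩
    · have h1' : ((2 * c : ℤ) : ZMod 4) = 0 := by exact_mod_cast h1
      have h2' : ((2 * d : ℤ) : ZMod 4) = 0 := by exact_mod_cast h2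
      rw [ZMod.intCast_zmod_eq_zero_iff_dvd] at h1' h2'
      exact absurd (Int.even_iff.2 (by omega)) (hd (Int.even_iff.2 (by omega)))
  obtain ⟨hc, d, rfl⟩ := hpar
  have hodd : Odd (c ^ 2 + (4 * d) ^ 2) := by
    rw [show (4 * d) ^ 2 = 2 * (8 * d ^ 2) by ring]
    exact (hc.pow).add_even (even_two_mul _)
  have hcd' : IsCoprime d (c ^ 2 + (4 * d) ^ 2) := by
    have := (hcd.of_mul_right_right.symm.pow_right (n := 2)).add_mul_left_right (16 * d)
    rwa [show c ^ 2 + d * (16 * d) = c ^ 2 + (4 * d) ^ 2 by ring] at this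
  obtain ⟨t, s, rfl, hs, rfl⟩ := Int.exists_cubes_of_mul_eq_cube (by linarith) hcd'
  obtain ⟨a, b, hca, hdb⟩ := exists_of_sq_add_sq_eq_cube hcd hs (hs ▸ hodd)
  have hab : IsCoprime a b := by
    rw [hca, hdb] at hcd
    exact hcd.of_mul_left_left.of_mul_right_left
  rw [hca, Int.odd_mul] at hc
  refine ⟨a, b, t, s, hab, hc.1, ?_, hdb.symm, rfl⟩
  have hb : Odd (3 * a ^ 2 - b ^ 2) := by
    have := hc.2
    rw [show 3 * a ^ 2 - b ^ 2 = (a ^ 2 - 3 * b ^ 2) + 2 * (a ^ 2 + b ^ 2) by ring]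
    exact this.add_even (even_two_mul _)
  have h4 : IsCoprime (4 : ℤ) (3 * a ^ 2 - b ^ 2) := by
    rw [show (4 : ℤ) = 2 ^ 2 by norm_num]
    exact (Int.isCoprime_two_left.2 hb).pow_left
  exact h4.dvd_of_dvd_mul_right ⟨t ^ 3, hdb.symm⟩

theorem three_dvd_of_dual_cubic {a b t : ℤ} (hab : IsCoprime a b) (hb : 4 ∣ b)
    (h : b * (3 * a ^ 2 - b ^ 2) = 4 * t ^ 3) : 3 ∣ b := by
  by_contra h3
  obtain ⟨b, rfl⟩ := hb
  have h3b : IsCoprime b 3 := by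
    refine (Int.prime_three.coprime_iff_not_dvd.2 fun hd => h3 (hd.mul_left 4)).symm
  have hcop : IsCoprime b (3 * a ^ 2 - (4 * b) ^ 2) := by
    have := (h3b.mul_right (hab.of_mul_right_right.symm.pow_right (n := 2))).add_mul_left_right
      (-16 * b)
    rwa [show 3 * a ^ 2 + b * (-16 * b) = 3 * a ^ 2 - (4 * b) ^ 2 by ring] at this
  obtain ⟨r, s, rfl, hs, rfl⟩ := Int.exists_cubes_of_mul_eq_cube (by linarith) hcop
  have hm := congrArg (Int.cast : ℤ → ZMod 9) hs
  push_cast at hm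
  have key : ∀ x y z : ZMod 9, 3 * x ^ 2 - (4 * y ^ 3) ^ 2 = z ^ 3 → y ^ 3 = 0 := by decide
  have h0 := key _ _ _ hm
  have h0' : ((r ^ 3 : ℤ) : ZMod 9) = 0 := by exact_mod_cast h0
  rw [ZMod.intCast_zmod_eq_zero_iff_dvd] at h0'
  exact h3 ((dvd_trans (by norm_num) h0').mul_left 4)

/-- The second half of the descent: the dual isogeny, factoring over `ℤ[√3]`. -/
theorem exists_cubic_of_dual_cubic {a b t : ℤ} (hab : IsCoprime a b) (ha : Odd a) (hb : 4 ∣ b)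
    (h : b * (3 * a ^ 2 - b ^ 2) = 4 * t ^ 3) :
    ∃ c e r s : ℤ, IsCoprime c e ∧ e * (c ^ 2 + e ^ 2) = 4 * r ^ 3 ∧ t = 3 * (r * s) := by
  have h3 := three_dvd_of_dual_cubic hab hb h
  obtain ⟨b, rfl⟩ : (12 : ℤ) ∣ b := by omega
  have ha3 : IsCoprime a 3 :=
    (hab.of_isCoprime_of_dvd_right (show (3 : ℤ) ∣ 12 * b from ⟨4 * b, by ring⟩))
  have ht : (3 : ℤ) ∣ t := by
    refine Int.prime_three.dvd_of_dvd_pow (n := 3) ?_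
    exact (by norm_num : IsCoprime (3 : ℤ) 4).dvd_of_dvd_mul_left
      ⟨12 * b * (a ^ 2 - 48 * b ^ 2), by rw [← h]; ring⟩
  obtain ⟨t, rfl⟩ := ht
  have h3b : (3 : ℤ) ∣ b := by
    have hc : IsCoprime (3 : ℤ) (a ^ 2 - 48 * b ^ 2) := by
      have := (ha3.symm.pow_right (n := 2)).add_mul_left_right (-16 * b ^ 2)
      rwa [show a ^ 2 + 3 * (-16 * b ^ 2) = a ^ 2 - 48 * b ^ 2 by ring] at this
    exact hc.dvd_of_dvd_mul_right ⟨t ^ 3, by linarith⟩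
  obtain ⟨b, rfl⟩ := h3b
  have hab₁ : IsCoprime a b := hab.of_isCoprime_of_dvd_right ⟨36, by ring⟩
  have hcop : IsCoprime b (a ^ 2 - 3 * (12 * b) ^ 2) := by
    have := (hab₁.symm.pow_right (n := 2)).add_mul_left_right (-432 * b)
    rwa [show a ^ 2 + b * (-432 * b) = a ^ 2 - 3 * (12 * b) ^ 2 by ring] at this
  obtain ⟨r, s, rfl, hs, rfl⟩ := Int.exists_cubes_of_mul_eq_cube (z := t) (by linarith) hcop
  have hodd : Odd (a ^ 2 - 3 * (12 * r ^ 3) ^ 2) := by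
    rw [show 3 * (12 * r ^ 3) ^ 2 = 2 * (216 * (r ^ 3) ^ 2) by ring]
    exact ha.pow.sub_even (even_two_mul _)
  obtain ⟨c, e, hce, he⟩ := exists_of_sq_sub_three_mul_sq_eq_cube
    (hab.of_isCoprime_of_dvd_right ⟨1, by ring⟩) hs (hs ▸ hodd) rfl
  exact ⟨c, e, r, s, hce, he, rfl⟩

theorem eq_zero_of_mul_sq_add_sq_eq_four_mul_cube {c d z : ℤ} (hcd : IsCoprime c d)
    (h : d * (c ^ 2 + d ^ 2) = 4 * z ^ 3) : z = 0 := by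
  induction hn : z.natAbs using Nat.strong_induction_on generalizing c d z with
  | _ n ih =>
    subst hn
    by_contra hz
    obtain ⟨a, b, t, s, hab, ha, hb, hab', rfl⟩ := exists_dual_cubic_of_cubic hcd h
    obtain ⟨c', e, r, s', hce, he, rfl⟩ := exists_cubic_of_dual_cubic hab ha hb hab'
    have hr : r ≠ 0 := by rintro rfl; simp at hz
    have hs : s ≠ 0 := by rintro rfl; simp at hz
    have hs' : s' ≠ 0 := by rintro rfl; simp at hz
    refine hr (ih r.natAbs ?_ hce he rfl)
    simp only [Int.natAbs_mul]
    have h1 := Int.natAbs_pos.2 hr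
    have h2 : 1 ≤ s'.natAbs * s.natAbs :=
      Nat.mul_pos (Int.natAbs_pos.2 hs') (Int.natAbs_pos.2 hs)
    rw [show Int.natAbs 3 = 3 from rfl]
    nlinarith

/-- There are no rational numbers `x, y` with `y² = x³ − 16`; equivalently, the elliptic
curve `E : y² = x³ − 16` over `ℚ` has no affine rational points. -/
theorem no_rational_points_y_sq_eq_x_cubed_sub_sixteen :
    ∀ x y : ℚ, y ^ 2 ≠ x ^ 3 - 16 := by
  intro x y hxy
  obtain ⟨c, d, hd, hcd, hy⟩ : ∃ c d : ℤ, d ≠ 0 ∧ IsCoprime c d ∧ y * d = 4 * c := by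
    refine ⟨(y / 4).num, (y / 4).den, by simp, (y / 4).isCoprime_num_den, ?_⟩
    have := Rat.mul_den_eq_num (y / 4)
    push_cast
    linarith
  have hx : (x * d) ^ 3 = ((16 * (d * (c ^ 2 + d ^ 2)) : ℤ) : ℚ) := by
    push_cast
    rw [mul_pow, show x ^ 3 = y ^ 2 + 16 by linarith]
    linear_combination (d * (y * d + 4 * c)) * hy
  obtain ⟨n, hn⟩ := IsIntegrallyClosed.exists_algebraMap_eq_of_isIntegral_pow (R := ℤ)
    (x := x * d) (n := 3) (by norm_num) (by rw [hx]; exact isIntegral_algebraMap)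
  rw [← hn] at hx
  replace hx : n ^ 3 = 16 * (d * (c ^ 2 + d ^ 2)) := by
    simp only [eq_intCast] at hx
    exact_mod_cast hx
  obtain ⟨n, rfl⟩ : (2 : ℤ) ∣ n :=
    Int.prime_two.dvd_of_dvd_pow (n := 3) ⟨8 * (d * (c ^ 2 + d ^ 2)), by linarith⟩
  obtain ⟨z, rfl⟩ : (2 : ℤ) ∣ n :=
    Int.prime_two.dvd_of_dvd_pow (n := 3) ⟨d * (c ^ 2 + d ^ 2), by linarith⟩
  have h : d * (c ^ 2 + d ^ 2) = 4 * z ^ 3 := by linarith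
  have hz := eq_zero_of_mul_sq_add_sq_eq_four_mul_cube hcd h
  have hpos : 0 < c ^ 2 + d ^ 2 := by positivity
  rw [hz] at h
  have := mul_ne_zero hd hpos.ne'
  exact this (by rw [h]; norm_num)
end

section
/- The rational solutions of y² = x³ + 16 are exactly (x, y) = (0, 4) and (x, y) = (0, −4); that is, for x, y ∈ ℚ, y² = x³ + 16 holds if and only if x = 0 and y = ±4. -/
theorem cube_sub_three_mul_sq_add_one_ne_zero (t : ℚ) : t ^ 3 - 3 * t ^ 2 + 1 ≠ 0 := by
  intro h
  have hq : (t.den : ℚ) ≠ 0 := by exact_mod_cast t.den_nz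
  have hZ : t.num ^ 3 - 3 * t.num ^ 2 * (t.den : ℤ) + (t.den : ℤ) ^ 3 = 0 := by
    rw [← Rat.num_div_den t] at h
    field_simp at h
    have : (t.num : ℚ) ^ 3 - 3 * t.num ^ 2 * (t.den : ℚ) + (t.den : ℚ) ^ 3 = 0 := by
      linear_combination h
    exact_mod_cast this
  have hpar := congrArg Even hZ
  simp only [Int.even_add, Int.even_sub, Int.even_mul, Int.even_pow, Int.even_coe_nat] at hpar
  have h3 : ¬ Even (3 : ℤ) := by decide
  have hnum : Even t.num := by simp [h3] at hpar; tauto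
  have hden : Even t.den := by simp [h3] at hpar; tauto
  have hdvd := Nat.dvd_gcd (Int.natAbs_even.mpr hnum).two_dvd hden.two_dvd
  rw [t.reduced.gcd_eq_one] at hdvd
  norm_num at hdvd

theorem cube_add_sixty_four_ne_twelve_mul_sq (x : ℚ) : x ^ 3 + 64 ≠ 12 * x ^ 2 := fun h ↦
  cube_sub_three_mul_sq_add_one_ne_zero (x / 4) (by linear_combination h / 64)

/-- The 3-isogeny from `y² = x³ + 16` to the Fermat cubic. -/
theorem fermat_cubic_of_sq_eq_cube_add_sixteen {x y : ℚ} (h : y ^ 2 = x ^ 3 + 16) :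
    (36 * x ^ 3 + y * (x ^ 3 - 128)) ^ 3 + (36 * x ^ 3 - y * (x ^ 3 - 128)) ^ 3 =
      (6 * x * (x ^ 3 + 64)) ^ 3 := by
  linear_combination 216 * x ^ 3 * (x ^ 3 - 128) ^ 2 * h

theorem eq_zero_of_sq_eq_cube_add_sixteen {x y : ℚ} (h : y ^ 2 = x ^ 3 + 16) : x = 0 := by
  by_contra hx
  have hc : 6 * x * (x ^ 3 + 64) ≠ 0 := by
    refine mul_ne_zero (mul_ne_zero (by norm_num) hx) fun h0 ↦ ?_
    nlinarith [sq_nonneg y]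
  have hab : (36 * x ^ 3 + y * (x ^ 3 - 128)) * (36 * x ^ 3 - y * (x ^ 3 - 128)) ≠ 0 := by
    intro h0
    apply cube_add_sixty_four_ne_twelve_mul_sq x
    apply (Odd.strictMono_pow (show Odd 3 by decide)).injective
    linear_combination -h0 - (x ^ 3 - 128) ^ 2 * h
  exact fermatLastTheoremFor_iff_rat.mp fermatLastTheoremThree _ _ _
    (left_ne_zero_of_mul hab) (right_ne_zero_of_mul hab) hc
    (fermat_cubic_of_sq_eq_cube_add_sixteen h)

/-- The rational solutions of `y² = x³ + 16` are exactly `(0, 4)` and `(0, −4)`. -/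
theorem rational_points_y_sq_eq_x_cubed_add_sixteen :
    ∀ x y : ℚ, y ^ 2 = x ^ 3 + 16 ↔ (x = 0 ∧ (y = 4 ∨ y = -4)) := by
  intro x y
  constructor
  · intro h
    obtain rfl := eq_zero_of_sq_eq_cube_add_sixteen h
    exact ⟨rfl, sq_eq_sq_iff_eq_or_eq_neg.mp (by linear_combination h)⟩
  · rintro ⟨rfl, rfl | rfl⟩ <;> norm_num
end
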